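/- arXiv:1601.02568 — 11 statements merged into one kernel-verified Lean document; each statement's English description precedes it below -/
import Mathlib

section
/- Let E₁ be a real normed space, let E₂ and F be real Banach spaces, let V ⊆ E₁ be open, let a < b be real numbers, let p ∈ [1,∞], let k ∈ ℕ ∪ {∞}, and let f : V × E₂ → F be a map of class C^{k+1} such that f(x,·) : E₂ → F is linear for each x ∈ V. Then there is a map f̃ : C([a,b],E₁) × L^p([a,b],E₂) → L^p([a,b],F) such that f̃(η,[γ]) is the a.e.-class of t ↦ f(η(t),γ(t)) whenever η([a,b]) ⊆ V and [γ] ∈ L^p([a,b],E₂), and f̃ is of class C^k on the open subset {η ∈ C([a,b],E₁) : η([a,b]) ⊆ V} × L^p([a,b],E₂). -/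
open MeasureTheory Set
open scoped ENNReal

attribute [local instance] MeasureTheory.Measure.Subtype.measureSpace

open Classical in
/-- Post-composition by a map, as a map on continuous functions (zero when not continuous). -/
noncomputable def postMap {K E F : Type*} [TopologicalSpace K] [TopologicalSpace E]
    [TopologicalSpace F] [Zero F] (g : E → F) (η : C(K, E)) : C(K, F) :=
  if h : Continuous (fun t => g (η t)) then ⟨fun t => g (η t), h⟩ else 0

theorem postMap_apply {K E F : Type*} [TopologicalSpace K] [TopologicalSpace E]
    [TopologicalSpace F] [Zero F] {g : E → F} {V : Set E} (hg : ContinuousOn g V)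
    {η : C(K, E)} (hη : ∀ t, η t ∈ V) (t : K) : postMap g η t = g (η t) := by
  have h : Continuous (fun t => g (η t)) := hg.comp_continuous η.continuous hη
  simp [postMap, h]

theorem postMap_continuousOn {K E F : Type*} [TopologicalSpace K] [LocallyCompactSpace K]
    [TopologicalSpace E] [TopologicalSpace F] [Zero F] {g : E → F} {V : Set E}
    (hg : ContinuousOn g V) :
    ContinuousOn (postMap g : C(K, E) → C(K, F)) {η | ∀ t, η t ∈ V} := by
  rw [continuousOn_iff_continuous_domRestrict]
  apply ContinuousMap.continuous_of_continuous_uncurry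
  have : (Function.uncurry fun (x : {η : C(K, E) | ∀ t, η t ∈ V}) (y : K) =>
      ({η : C(K, E) | ∀ t, η t ∈ V}.domRestrict (postMap g : C(K, E) → C(K, F)) x) y) =
      fun q => g (q.1.1 q.2) := by
    ext ⟨x, t⟩
    exact postMap_apply hg x.2 t
  rw [this]
  refine hg.comp_continuous ?_ (fun q => q.1.2 q.2)
  exact ContinuousEval.continuous_eval.comp
    ((continuous_subtype_val.comp continuous_fst).prodMk continuous_snd)

/-- Pointwise application. -/
noncomputable def applyL (K E F : Type*) [TopologicalSpace K] [CompactSpace K]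
    [NormedAddCommGroup E] [NormedSpace ℝ E] [NormedAddCommGroup F] [NormedSpace ℝ F] :
    C(K, E →L[ℝ] F) →L[ℝ] C(K, E) →L[ℝ] C(K, F) :=
  LinearMap.mkContinuous₂
    (LinearMap.mk₂ ℝ (fun (A : C(K, E →L[ℝ] F)) (h : C(K, E)) =>
        (⟨fun t => A t (h t), A.continuous.clm_apply h.continuous⟩ : C(K, F)))
      (fun _ _ _ => by ext; simp) (fun _ _ _ => by ext; simp)
      (fun _ _ _ => by ext; simp) (fun _ _ _ => by ext; simp)) 1
    (fun A h => by
      rw [ContinuousMap.norm_le _ (by positivity)]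
      intro t
      simp only [LinearMap.mk₂_apply, ContinuousMap.coe_mk, one_mul]
      exact (A t).le_of_opNorm_le_of_le (A.norm_coe_le_norm t) (h.norm_coe_le_norm t))

theorem applyL_apply {K E F : Type*} [TopologicalSpace K] [CompactSpace K]
    [NormedAddCommGroup E] [NormedSpace ℝ E] [NormedAddCommGroup F] [NormedSpace ℝ F]
    (A : C(K, E →L[ℝ] F)) (h : C(K, E)) (t : K) : applyL K E F A h t = A t (h t) := rfl

theorem isOpen_mapsInto {K E : Type*} [TopologicalSpace K] [CompactSpace K] [TopologicalSpace E]
    {V : Set E} (hV : IsOpen V) : IsOpen {η : C(K, E) | ∀ t, η t ∈ V} := by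
  have := ContinuousMap.isOpen_setOfPred_mapsTo (X := K) (isCompact_univ) hV
  simpa [MapsTo] using this

set_option maxHeartbeats 1000000 in
theorem postMap_hasFDerivAt {K E F : Type*} [TopologicalSpace K] [CompactSpace K]
    [LocallyCompactSpace K]
    [NormedAddCommGroup E] [NormedSpace ℝ E] [NormedAddCommGroup F] [NormedSpace ℝ F]
    {V : Set E} (hV : IsOpen V) {g : E → F} {g' : E → E →L[ℝ] F}
    (hg : ∀ x ∈ V, HasFDerivAt g (g' x) x) (hg' : ContinuousOn g' V)
    {η : C(K, E)} (hη : ∀ t, η t ∈ V) :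
    HasFDerivAt (postMap g : C(K, E) → C(K, F)) (applyL K E F (postMap g' η)) η := by
  have hgc : ContinuousOn g V := fun x hx => (hg x hx).continuousAt.continuousWithinAt
  have hO : {η : C(K, E) | ∀ t, η t ∈ V} ∈ nhds η := (isOpen_mapsInto hV).mem_nhds hη
  have hc : ContinuousAt (postMap g' : C(K, E) → C(K, E →L[ℝ] F)) η :=
    (postMap_continuousOn hg').continuousAt hO
  rw [hasFDerivAt_iff_isLittleO, Asymptotics.isLittleO_iff]
  intro ε hε
  obtain ⟨δ, hδ, hball⟩ := Metric.mem_nhds_iff.1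
    (Filter.inter_mem hO (hc.preimage_mem_nhds (Metric.ball_mem_nhds (postMap g' η) hε)))
  have key : ∀ t : K, ∀ y ∈ Metric.ball (η t) δ, y ∈ V ∧ ‖g' y - g' (η t)‖ ≤ ε := by
    intro t y hy
    have hξ : η + ContinuousMap.const K (y - η t) ∈ Metric.ball η δ := by
      rw [mem_ball_iff_norm, add_sub_cancel_left, ContinuousMap.norm_lt_iff _ hδ]
      intro s
      simpa using mem_ball_iff_norm.1 hy
    obtain ⟨h1, h2⟩ := hball hξ
    have e : (η + ContinuousMap.const K (y - η t)) t = y := by simp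
    refine ⟨by simpa using h1 t, ?_⟩
    have h3 : dist (postMap g' (η + ContinuousMap.const K (y - η t))) (postMap g' η) < ε :=
      Metric.mem_ball.1 (Set.mem_preimage.1 h2)
    have h4 := (ContinuousMap.dist_apply_le_dist t).trans h3.le
    rw [postMap_apply hg' h1, postMap_apply hg' hη, e, dist_eq_norm] at h4
    exact h4
  filter_upwards [Metric.ball_mem_nhds η hδ] with ξ hξ
  have hξV : ∀ t, ξ t ∈ V := (hball hξ).1
  rw [ContinuousMap.norm_le _ (by positivity)]
  intro t
  rw [ContinuousMap.sub_apply, ContinuousMap.sub_apply, applyL_apply, postMap_apply hgc hξV,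
    postMap_apply hgc hη, postMap_apply hg' hη, ContinuousMap.sub_apply]
  have hξt : ‖ξ t - η t‖ ≤ ‖ξ - η‖ := (ξ - η).norm_coe_le_norm t
  refine (Convex.norm_image_sub_le_of_norm_hasFDerivWithin_le' (s := Metric.ball (η t) δ)
    (f' := g') (C := ε)
    (fun x hx => (hg x (key t x hx).1).hasFDerivWithinAt) (fun x hx => (key t x hx).2)
    (convex_ball _ _) (Metric.mem_ball_self hδ) ?_).trans (by gcongr)
  rw [mem_ball_iff_norm] at hξ ⊢
  exact hξt.trans_lt hξ

universe uu vv ww in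
theorem postMap_contDiffOn_aux {K : Type ww} [TopologicalSpace K] [CompactSpace K]
    [LocallyCompactSpace K]
    {E : Type uu} [NormedAddCommGroup E] [NormedSpace ℝ E]
    {V : Set E} (hV : IsOpen V) (n : ℕ) :
    ∀ {F : Type (max uu vv)} [NormedAddCommGroup F] [NormedSpace ℝ F]
    {g : E → F}, ContDiffOn ℝ n g V →
    ContDiffOn ℝ n (postMap g : C(K, E) → C(K, F)) {η | ∀ t, η t ∈ V} := by
  induction n with
  | zero =>
    intro F _ _ g hg
    have := hg.continuousOn
    simp only [Nat.cast_zero, contDiffOn_zero]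
    exact postMap_continuousOn this
  | succ n ih =>
    intro F _ _ g hg
    rw [Nat.cast_succ] at hg ⊢
    have h1 := (contDiffOn_succ_iff_fderiv_of_isOpen hV).1 hg
    rw [contDiffOn_succ_iff_hasFDerivWithinAt_of_uniqueDiffOn (isOpen_mapsInto hV).uniqueDiffOn]
    refine ⟨by simp, fun η => applyL K E F (postMap (fderiv ℝ g) η), ?_, ?_⟩
    · exact (applyL K E F).contDiff.comp_contDiffOn (ih h1.2.2)
    · intro η hη
      refine (postMap_hasFDerivAt hV (fun x hx => ?_) h1.2.2.continuousOn hη).hasFDerivWithinAt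
      exact ((h1.1 x hx).differentiableAt (hV.mem_nhds hx)).hasFDerivAt

universe uu vv ww in
theorem postMap_contDiffOn {K : Type ww} [TopologicalSpace K] [CompactSpace K]
    [LocallyCompactSpace K]
    {E : Type uu} [NormedAddCommGroup E] [NormedSpace ℝ E]
    {V : Set E} (hV : IsOpen V) (k : ℕ∞)
    {F : Type vv} [NormedAddCommGroup F] [NormedSpace ℝ F]
    {g : E → F} (hg : ContDiffOn ℝ k g V) :
    ContDiffOn ℝ k (postMap g : C(K, E) → C(K, F)) {η | ∀ t, η t ∈ V} := by
  rw [contDiffOn_iff_forall_nat_le] at hg ⊢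
  intro m hm
  have hgm := hg m hm
  let e : ULift.{uu} F ≃L[ℝ] F := ContinuousLinearEquiv.ulift
  have h1 : ContDiffOn ℝ m (fun x => e.symm (g x)) V :=
    e.symm.contDiff.comp_contDiffOn hgm
  have h2 := postMap_contDiffOn_aux.{uu, vv, ww} (K := K) hV m h1
  have h3 := (ContinuousLinearMap.compLeftContinuous ℝ K (e : ULift.{uu} F →L[ℝ] F)).contDiff (n := m)
    |>.comp_contDiffOn h2
  refine h3.congr fun η hη => ?_
  ext t
  simp [postMap_apply hgm.continuousOn hη, postMap_apply h1.continuousOn hη]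

theorem stmt1
    {E₁ : Type*} [NormedAddCommGroup E₁] [NormedSpace ℝ E₁]
    {E₂ : Type*} [NormedAddCommGroup E₂] [NormedSpace ℝ E₂] [CompleteSpace E₂]
    {F : Type*} [NormedAddCommGroup F] [NormedSpace ℝ F] [CompleteSpace F]
    (V : Set E₁) (hV : IsOpen V)
    (a b : ℝ) (hab : a < b)
    (p : ℝ≥0∞) [Fact (1 ≤ p)]
    (k : ℕ∞)
    (f : E₁ → E₂ → F)
    (hf : ContDiffOn ℝ (k + 1) (fun q : E₁ × E₂ => f q.1 q.2) (V ×ˢ (univ : Set E₂)))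
    (hf_lin : ∀ x ∈ V, IsLinearMap ℝ (f x)) :
    ∃ Ftil : C(Icc a b, E₁) × Lp E₂ p (volume : Measure (Icc a b)) →
        Lp F p (volume : Measure (Icc a b)),
      (∀ η : C(Icc a b, E₁), (∀ t, η t ∈ V) →
        ∀ γ : Lp E₂ p (volume : Measure (Icc a b)),
          ⇑(Ftil (η, γ)) =ᵐ[volume] fun t => f (η t) (γ t)) ∧
      ContDiffOn ℝ k Ftil
        ({η : C(Icc a b, E₁) | ∀ t, η t ∈ V} ×ˢ
          (univ : Set (Lp E₂ p (volume : Measure (Icc a b))))) := by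
  have hVU : IsOpen (V ×ˢ (univ : Set E₂)) := hV.prod isOpen_univ
  have hD := (contDiffOn_succ_iff_fderiv_of_isOpen hVU).1 hf
  let g : E₁ → E₂ →L[ℝ] F := fun x =>
    (fderiv ℝ (fun q : E₁ × E₂ => f q.1 q.2) (x, 0)).comp (ContinuousLinearMap.inr ℝ E₁ E₂)
  have hg : ContDiffOn ℝ k g V := by
    have h1 : ContDiffOn ℝ k
        (fun x : E₁ => fderiv ℝ (fun q : E₁ × E₂ => f q.1 q.2) (x, (0 : E₂))) V :=
      hD.2.2.comp (contDiff_id.prodMk contDiff_const).contDiffOn (fun x hx => ⟨hx, mem_univ _⟩)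
    exact h1.clm_comp contDiffOn_const
  have hgf : ∀ x ∈ V, ∀ y, g x y = f x y := by
    intro x hx y
    have hd : HasFDerivAt (fun q : E₁ × E₂ => f q.1 q.2) _ (x, (0 : E₂)) :=
      ((hD.1 (x, 0) ⟨hx, mem_univ _⟩).differentiableAt
        (hVU.mem_nhds ⟨hx, mem_univ _⟩)).hasFDerivAt
    have hl : HasDerivAt (fun s : ℝ => ((x, s • y) : E₁ × E₂)) (0, y) 0 := by
      have : HasDerivAt (fun s : ℝ => s • y) y 0 := by
        simpa using (hasDerivAt_id (0 : ℝ)).smul_const y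
      exact (hasDerivAt_const (0 : ℝ) x).prodMk this
    have hd' : HasFDerivAt (fun q : E₁ × E₂ => f q.1 q.2)
        (fderiv ℝ (fun q : E₁ × E₂ => f q.1 q.2) (x, 0)) (x, (0 : ℝ) • y) := by
      simpa using hd
    have h1 := hd'.comp_hasDerivAt (0 : ℝ) hl
    have h2 : HasDerivAt (fun s : ℝ => s • f x y) (f x y) 0 := by
      simpa using (hasDerivAt_id (0 : ℝ)).smul_const (f x y)
    have h3 : ((fun q : E₁ × E₂ => f q.1 q.2) ∘ fun s : ℝ => ((x, s • y) : E₁ × E₂)) =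
        fun s : ℝ => s • f x y := by
      ext s
      exact (hf_lin x hx).map_smul s y
    rw [h3] at h1
    exact h1.unique h2
  have : IsFiniteMeasure (volume : Measure (Icc a b)) := ⟨by
    rw [Measure.Subtype.volume_univ measurableSet_Icc.nullMeasurableSet]
    exact measure_Icc_lt_top⟩
  let B := (ContinuousLinearMap.id ℝ (E₂ →L[ℝ] F)).holderL (volume : Measure (Icc a b)) ∞ p p
  let T := ContinuousMap.toLp (E := E₂ →L[ℝ] F) ∞ (volume : Measure (Icc a b)) ℝ
  refine ⟨fun q => B (T (postMap g q.1)) q.2, ?_, ?_⟩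
  · intro η hη γ
    have h1 : ⇑(B (T (postMap g η)) γ) =ᵐ[volume] fun t => (T (postMap g η) t) (γ t) :=
      (ContinuousLinearMap.id ℝ (E₂ →L[ℝ] F)).coeFn_holder (T (postMap g η)) γ
    have h2 : ⇑(T (postMap g η)) =ᵐ[volume] postMap g η := ContinuousMap.coeFn_toLp _ _
    filter_upwards [h1, h2] with t ht1 ht2
    rw [ht1, ht2, postMap_apply hg.continuousOn hη, hgf _ (hη t)]
  · have h1 := postMap_contDiffOn (K := Icc a b) hV k hg
    have h2 : ContDiffOn ℝ k (fun q : C(Icc a b, E₁) × Lp E₂ p (volume : Measure (Icc a b)) =>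
        B (T (postMap g q.1))) ({η : C(Icc a b, E₁) | ∀ t, η t ∈ V} ×ˢ univ) :=
      (B.comp T).contDiff.comp_contDiffOn (h1.comp contDiff_fst.contDiffOn (fun q hq => hq.1))
    exact h2.clm_apply contDiff_snd.contDiffOn
end

section
/- Let E₀ and E₁ be real normed spaces, let E₂ and F be real Banach spaces, let Λ ⊆ E₀ and V ⊆ E₁ be open, let a < b be real numbers, let p ∈ [1,∞], and let f : Λ × V × E₂ → F be a C¹-map such that f(λ,x,·) : E₂ → F is linear for all (λ,x) ∈ Λ × V. Then the parameter-dependent superposition map f̃ : Λ × {η ∈ C([a,b],E₁) : η([a,b]) ⊆ V} × L^p([a,b],E₂) → L^p([a,b],F), sending (λ, η, [γ]) to the a.e.-class of t ↦ f(λ, η(t), γ(t)), is well defined and continuous. -/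
open MeasureTheory Set
open scoped ENNReal

attribute [local instance] MeasureTheory.Measure.Subtype.measureSpace

theorem stmt2
    {E₀ : Type*} [NormedAddCommGroup E₀] [NormedSpace ℝ E₀]
    {E₁ : Type*} [NormedAddCommGroup E₁] [NormedSpace ℝ E₁]
    {E₂ : Type*} [NormedAddCommGroup E₂] [NormedSpace ℝ E₂] [CompleteSpace E₂]
    {F : Type*} [NormedAddCommGroup F] [NormedSpace ℝ F] [CompleteSpace F]
    (Λ : Set E₀) (hΛ : IsOpen Λ) (V : Set E₁) (hV : IsOpen V)
    (a b : ℝ) (hab : a < b)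
    (p : ℝ≥0∞) [Fact (1 ≤ p)]
    (f : E₀ → E₁ → E₂ → F)
    (hf : ContDiffOn ℝ 1 (fun q : E₀ × E₁ × E₂ => f q.1 q.2.1 q.2.2)
      (Λ ×ˢ V ×ˢ (univ : Set E₂)))
    (hf_lin : ∀ l ∈ Λ, ∀ x ∈ V, IsLinearMap ℝ (f l x)) :
    ∃ Ftil : E₀ × C(Icc a b, E₁) × Lp E₂ p (volume : Measure (Icc a b)) →
        Lp F p (volume : Measure (Icc a b)),
      (∀ l ∈ Λ, ∀ η : C(Icc a b, E₁), (∀ t, η t ∈ V) →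
        ∀ γ : Lp E₂ p (volume : Measure (Icc a b)),
          ⇑(Ftil (l, η, γ)) =ᵐ[volume] fun t => f l (η t) (γ t)) ∧
      ContinuousOn Ftil
        (Λ ×ˢ {η : C(Icc a b, E₁) | ∀ t, η t ∈ V} ×ˢ
          (univ : Set (Lp E₂ p (volume : Measure (Icc a b))))) := by
  classical
  let G : E₀ × E₁ → (E₂ →L[ℝ] F) := fun z =>
    (fderiv ℝ (fun q : E₀ × E₁ × E₂ => f q.1 q.2.1 q.2.2) (z.1, z.2, 0)).comp
      ((ContinuousLinearMap.inr ℝ E₀ (E₁ × E₂)).comp (ContinuousLinearMap.inr ℝ E₁ E₂))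
  have hopen : IsOpen (Λ ×ˢ V ×ˢ (univ : Set E₂)) := hΛ.prod (hV.prod isOpen_univ)
  have hGc : ContinuousOn G (Λ ×ˢ V) := by
    have h1 := hf.continuousOn_fderiv_of_isOpen hopen le_rfl
    have h2 : ContinuousOn (fun z : E₀ × E₁ =>
        fderiv ℝ (fun q : E₀ × E₁ × E₂ => f q.1 q.2.1 q.2.2) (z.1, z.2, (0 : E₂))) (Λ ×ˢ V) := by
      refine h1.comp (f := fun z : E₀ × E₁ => (z.1, z.2, (0 : E₂))) (by fun_prop) ?_
      rintro ⟨x, y⟩ ⟨hx, hy⟩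
      exact ⟨hx, hy, mem_univ _⟩
    exact h2.clm_comp continuousOn_const
  have hG : ∀ l ∈ Λ, ∀ x ∈ V, ∀ v, G (l, x) v = f l x v := by
    intro l hl x hx v
    have hd : HasFDerivAt (fun q : E₀ × E₁ × E₂ => f q.1 q.2.1 q.2.2)
        (fderiv ℝ (fun q : E₀ × E₁ × E₂ => f q.1 q.2.1 q.2.2) (l, x, 0)) (l, x, 0) :=
      ((hf.differentiableOn one_ne_zero).differentiableAt
        (hopen.mem_nhds ⟨hl, hx, mem_univ _⟩)).hasFDerivAt
    have hc : HasDerivAt (fun s : ℝ => ((l, x, s • v) : E₀ × E₁ × E₂)) (0, 0, v) 0 := by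
      refine (hasDerivAt_const _ _).prodMk ((hasDerivAt_const _ _).prodMk ?_)
      simpa using (hasDerivAt_id (0 : ℝ)).smul_const v
    have h1 := HasFDerivAt.comp_hasDerivAt_of_eq (0 : ℝ) hd hc (by simp)
    have h2 : HasDerivAt (fun s : ℝ => s • f l x v) (f l x v) 0 := by
      simpa using (hasDerivAt_id (0 : ℝ)).smul_const (f l x v)
    have h3 : ((fun q : E₀ × E₁ × E₂ => f q.1 q.2.1 q.2.2) ∘
        fun s : ℝ => ((l, x, s • v) : E₀ × E₁ × E₂)) = fun s : ℝ => s • f l x v := by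
      funext s
      exact (hf_lin l hl x hx).map_smul s v
    rw [h3] at h1
    exact h1.unique h2
  let S : Set (E₀ × C(Icc a b, E₁)) := {z | z.1 ∈ Λ ∧ ∀ t, z.2 t ∈ V}
  let A : C(S, C(Icc a b, E₂ →L[ℝ] F)) := ContinuousMap.curry
    ⟨fun w : S × Icc a b => G (w.1.1.1, w.1.1.2 w.2), by
      refine hGc.comp_continuous (f := fun w : S × Icc a b => (w.1.1.1, w.1.1.2 w.2)) ?_ ?_
      · fun_prop
      · intro w
        exact ⟨w.1.2.1, w.1.2.2 _⟩⟩
  haveI : IsFiniteMeasure (volume : Measure (Icc a b)) := by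
    refine ⟨?_⟩
    rw [Measure.Subtype.volume_univ measurableSet_Icc.nullMeasurableSet]
    exact measure_Icc_lt_top
  let T : C(Icc a b, E₂ →L[ℝ] F) →L[ℝ] Lp (E₂ →L[ℝ] F) ∞ (volume : Measure (Icc a b)) :=
    ContinuousMap.toLp ∞ volume ℝ
  let H := ContinuousLinearMap.holderL (volume : Measure (Icc a b)) ∞ p p
    (ContinuousLinearMap.id ℝ (E₂ →L[ℝ] F))
  refine ⟨fun z => if h : (z.1, z.2.1) ∈ S then H (T (A ⟨_, h⟩)) z.2.2 else 0, ?_, ?_⟩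
  · intro l hl η hη γ
    have h : (l, η) ∈ S := ⟨hl, hη⟩
    simp only [h, dif_pos]
    have e1 : ⇑(T (A ⟨_, h⟩)) =ᵐ[volume] A ⟨_, h⟩ :=
      ContinuousMap.coeFn_toLp (p := ∞) (𝕜 := ℝ) volume (A ⟨_, h⟩)
    have e2 := ContinuousLinearMap.coeFn_holder (r := p)
      (B := ContinuousLinearMap.id ℝ (E₂ →L[ℝ] F)) (T (A ⟨_, h⟩)) γ
    filter_upwards [e1, e2] with t h1 h2
    refine Eq.trans h2 ?_
    rw [h1]
    exact hG l hl _ (hη t) _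
  · rw [continuousOn_iff_continuous_restrict]
    have key : Continuous fun w : (Λ ×ˢ {η : C(Icc a b, E₁) | ∀ t, η t ∈ V} ×ˢ
          (univ : Set (Lp E₂ p (volume : Measure (Icc a b)))) : Set _) =>
        H (T (A ⟨(w.1.1, w.1.2.1), ⟨w.2.1, w.2.2.1⟩⟩)) w.1.2.2 := by
      refine ((H.continuous.comp T.continuous).comp (A.continuous.comp ?_)).clm_apply ?_
      · exact Continuous.subtype_mk (by fun_prop) _
      · fun_prop
    refine key.congr ?_
    intro w
    have h : (w.1.1, w.1.2.1) ∈ S := ⟨w.2.1, w.2.2.1⟩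
    simp only [restrict_apply, h, dif_pos]
end

section
/- Let E be a real Banach space, U ⊆ E a subset, a < b real numbers, t₀ ∈ [a,b], and f : [a,b] × U → E a map. Assume there is a Lebesgue-integrable function g : [a,b] → [0,∞) such that for every t ∈ [a,b] the map f(t,·) : U → E is Lipschitz with constant g(t). Let γ, η : [a,b] → U be continuous maps such that s ↦ f(s,γ(s)) and s ↦ f(s,η(s)) are Bochner integrable on [a,b] and γ(t) = γ(t₀) + ∫_{t₀}^{t} f(s,γ(s)) ds and η(t) = η(t₀) + ∫_{t₀}^{t} f(s,η(s)) ds for all t ∈ [a,b]. If γ(t₀) = η(t₀), then γ = η on [a,b]. -/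
open MeasureTheory Set

theorem stmt9
    {E : Type*} [NormedAddCommGroup E] [NormedSpace ℝ E] [CompleteSpace E]
    (U : Set E) (a b : ℝ) (hab : a < b) (t₀ : ℝ) (ht₀ : t₀ ∈ Icc a b)
    (f : ℝ → E → E) (g : ℝ → ℝ)
    (hg_int : IntegrableOn g (Icc a b) volume)
    (hg_nonneg : ∀ t ∈ Icc a b, 0 ≤ g t)
    (hlip : ∀ t ∈ Icc a b, LipschitzOnWith (Real.toNNReal (g t)) (f t) U)
    (γ η : ℝ → E)
    (hγc : ContinuousOn γ (Icc a b)) (hγU : ∀ t ∈ Icc a b, γ t ∈ U)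
    (hηc : ContinuousOn η (Icc a b)) (hηU : ∀ t ∈ Icc a b, η t ∈ U)
    (hγint : IntegrableOn (fun s => f s (γ s)) (Icc a b) volume)
    (hηint : IntegrableOn (fun s => f s (η s)) (Icc a b) volume)
    (hγeq : ∀ t ∈ Icc a b, γ t = γ t₀ + ∫ s in t₀..t, f s (γ s))
    (hηeq : ∀ t ∈ Icc a b, η t = η t₀ + ∫ s in t₀..t, f s (η s))
    (h0 : γ t₀ = η t₀) :
    ∀ t ∈ Icc a b, γ t = η t := by
  have hsub : ∀ x ∈ Icc a b, ∀ y ∈ Icc a b, uIcc x y ⊆ Icc a b := fun x hx y hy =>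
    ordConnected_Icc.uIcc_subset hx hy
  have hii : ∀ {F : Type _} [NormedAddCommGroup F] (φ : ℝ → F), IntegrableOn φ (Icc a b) volume →
      ∀ x ∈ Icc a b, ∀ y ∈ Icc a b, IntervalIntegrable φ volume x y := by
    intro F _ φ hφ x hx y hy
    exact (hφ.mono_set (hsub x hx y hy)).intervalIntegrable
  have hgi : ∀ x ∈ Icc a b, ∀ y ∈ Icc a b, IntervalIntegrable g volume x y := by
    intro x hx y hy
    exact (hg_int.mono_set (hsub x hx y hy)).intervalIntegrable
  have key : ∀ x ∈ Icc a b, ∀ y ∈ Icc a b, γ x = η x →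
      γ y - η y = ∫ s in x..y, (f s (γ s) - f s (η s)) := by
    intro x hx y hy hxy
    rw [intervalIntegral.integral_sub (hii _ hγint x hx y hy) (hii _ hηint x hx y hy),
      ← intervalIntegral.integral_interval_sub_left (hii _ hγint t₀ ht₀ y hy) (hii _ hγint t₀ ht₀ x hx),
      ← intervalIntegral.integral_interval_sub_left (hii _ hηint t₀ ht₀ y hy) (hii _ hηint t₀ ht₀ x hx)]
    have e1 := hγeq x hx
    have e2 := hηeq x hx
    have e3 : (∫ s in t₀..x, f s (γ s)) = ∫ s in t₀..x, f s (η s) := by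
      rw [e1, e2, h0] at hxy
      exact add_left_cancel hxy
    rw [hγeq y hy, hηeq y hy, h0, e3]
    abel
  have hG : ContinuousOn (fun t => ∫ s in a..t, g s) (Icc a b) := by
    have := intervalIntegral.continuousOn_primitive_interval (f := g) (μ := volume) (a := a) (b := b)
      (by rwa [uIcc_of_le hab.le])
    rwa [uIcc_of_le hab.le] at this
  have ha : a ∈ Icc a b := left_mem_Icc.2 hab.le
  have : PreconnectedSpace (Icc a b) := isPreconnected_iff_preconnectedSpace.1 isPreconnected_Icc
  have hclopen : IsClopen {t : Icc a b | γ t = η t} := by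
    constructor
    · exact isClosed_eq (continuousOn_iff_continuous_restrict.1 hγc)
        (continuousOn_iff_continuous_restrict.1 hηc)
    · rw [Metric.isOpen_iff]
      rintro ⟨x, hx⟩ hxy
      simp only [mem_setOf_eq] at hxy
      obtain ⟨δ, hδ, hd⟩ := Metric.continuousOn_iff.1 hG x hx (1/2) (by norm_num)
      refine ⟨δ / 2, by positivity, ?_⟩
      rintro ⟨z, hz⟩ hzx
      simp only [Metric.mem_ball, Subtype.dist_eq] at hzx
      have hK : IsCompact (Icc a b ∩ Metric.closedBall x (δ/2)) :=
        isCompact_Icc.inter_right Metric.isClosed_closedBall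
      obtain ⟨m, ⟨hm, hmx⟩, hmax⟩ := hK.exists_isMaxOn ⟨x, hx, by simp; positivity⟩
        ((hγc.sub hηc).norm.mono inter_subset_left)
      have hmax' : ∀ s ∈ Icc a b, dist s x ≤ δ/2 → ‖γ s - η s‖ ≤ ‖γ m - η m‖ :=
        fun s hs h => hmax ⟨hs, h⟩
      have hgm : |∫ s in x..m, g s| ≤ 1/2 := by
        rw [← intervalIntegral.integral_interval_sub_left (hgi a ha m hm) (hgi a ha x hx)]
        have := hd m hm (lt_of_le_of_lt hmx (by linarith))
        rw [Real.dist_eq] at this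
        exact this.le
      have hb : ‖γ m - η m‖ ≤ |∫ s in x..m, ‖γ m - η m‖ * g s| := by
        conv_lhs => rw [key x hx m hm hxy]
        apply intervalIntegral.norm_integral_le_abs_of_norm_le
        · refine (ae_restrict_mem measurableSet_uIoc).mono ?_
          intro s hs
          have hs' := uIoc_subset_uIcc hs
          have hsI := hsub x hx m hm hs'
          have h1 := (hlip s hsI).norm_sub_le (hγU s hsI) (hηU s hsI)
          rw [Real.coe_toNNReal _ (hg_nonneg s hsI)] at h1
          have h2 : dist s x ≤ δ/2 := by
            have h3 := abs_sub_left_of_mem_uIcc hs'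
            have h4 : dist m x ≤ δ/2 := hmx
            rw [Real.dist_eq] at *
            linarith
          calc _ ≤ _ := h1
            _ ≤ g s * ‖γ m - η m‖ :=
              mul_le_mul_of_nonneg_left (hmax' s hsI h2) (hg_nonneg s hsI)
            _ = _ := mul_comm _ _
        · exact (hgi x hx m hm).const_mul _
      rw [intervalIntegral.integral_const_mul, abs_mul, abs_norm] at hb
      have hM := norm_nonneg (γ m - η m)
      have hM0 : ‖γ m - η m‖ ≤ 0 := by nlinarith
      have := (hmax' z hz hzx.le).trans hM0
      exact sub_eq_zero.1 (norm_le_zero_iff.1 this)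
  have huniv := hclopen.eq_univ ⟨⟨t₀, ht₀⟩, h0⟩
  intro t ht
  have : (⟨t, ht⟩ : Icc a b) ∈ {t : Icc a b | γ t = η t} := huniv ▸ mem_univ _
  exact this
end

section
/- Let E and F be real normed spaces, U ⊆ E open, r > 0, γ : ℝ → E a map with γ([0,r]) ⊆ U that is C¹ on [0,r] (with one-sided derivatives at the endpoints), and f : U → F a C²-map whose Fréchet derivative at γ(0) vanishes, Df(γ(0)) = 0. Then the map η : [0,r²] → F, η(t) := f(γ(√t)), is C¹ on [0,r²], and its right-sided derivative at 0 equals ½·D²f(γ(0))(γ'(0), γ'(0)), where γ'(0) denotes the right-sided derivative of γ at 0 and D²f(γ(0)) the second Fréchet derivative of f at γ(0) regarded as a continuous symmetric bilinear map. -/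
open Set

theorem stmt10
    {E : Type*} [NormedAddCommGroup E] [NormedSpace ℝ E]
    {F : Type*} [NormedAddCommGroup F] [NormedSpace ℝ F]
    (U : Set E) (hU : IsOpen U) (r : ℝ) (hr : 0 < r)
    (γ : ℝ → E) (hγU : MapsTo γ (Icc 0 r) U)
    (hγ : ContDiffOn ℝ 1 γ (Icc 0 r))
    (f : E → F) (hf : ContDiffOn ℝ 2 f U)
    (hdf : fderiv ℝ f (γ 0) = 0) :
    ContDiffOn ℝ 1 (fun t => f (γ (Real.sqrt t))) (Icc 0 (r ^ 2)) ∧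
    derivWithin (fun t => f (γ (Real.sqrt t))) (Icc 0 (r ^ 2)) 0 =
      (2⁻¹ : ℝ) • iteratedFDeriv ℝ 2 f (γ 0)
        ![derivWithin γ (Icc 0 r) 0, derivWithin γ (Icc 0 r) 0] := by
  classical
  set S : Set ℝ := Icc 0 r with hS
  set v := derivWithin γ S 0 with hv
  have h0S : (0:ℝ) ∈ S := ⟨le_refl _, hr.le⟩
  have hr2 : 0 < r ^ 2 := by positivity
  have hudS : UniqueDiffOn ℝ S := uniqueDiffOn_Icc hr
  have hudT : UniqueDiffOn ℝ (Icc 0 (r ^ 2)) := uniqueDiffOn_Icc hr2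
  have hγ1 := (contDiffOn_one_iff_derivWithin hudS).1 hγ
  have hγd : ∀ s ∈ S, HasDerivWithinAt γ (derivWithin γ S s) S s :=
    fun s hs => (hγ1.1 s hs).hasDerivWithinAt
  have hf1 : ContDiffOn ℝ 1 (fderiv ℝ f) U := hf.fderiv_of_isOpen hU (by norm_num)
  have hfd : ∀ x ∈ U, HasFDerivAt f (fderiv ℝ f x) x := fun x hx =>
    ((hf.differentiableOn (by norm_num)).differentiableAt (hU.mem_nhds hx)).hasFDerivAt
  have hf2 : ∀ x ∈ U, HasFDerivAt (fderiv ℝ f) (fderiv ℝ (fderiv ℝ f) x) x := fun x hx =>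
    ((hf1.differentiableOn (by norm_num)).differentiableAt (hU.mem_nhds hx)).hasFDerivAt
  set c : ℝ → (E →L[ℝ] F) := fun s => fderiv ℝ f (γ s) with hc
  have hc0 : c 0 = 0 := hdf
  have hcd : HasDerivWithinAt c (fderiv ℝ (fderiv ℝ f) (γ 0) v) S 0 :=
    (hf2 _ (hγU h0S)).comp_hasDerivWithinAt (0:ℝ) (hγd 0 h0S)
  have hcc : ContinuousOn c S := hf1.continuousOn.comp hγ.continuousOn hγU
  set d : F := (2⁻¹ : ℝ) • fderiv ℝ (fderiv ℝ f) (γ 0) v v with hd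
  set h0 : ℝ → F := fun s => (2⁻¹ : ℝ) • (s⁻¹ • c s) (derivWithin γ S s) with hh0
  set h : ℝ → F := Function.update h0 0 d with hh
  have hcont : ContinuousOn h S := by
    rw [hh, continuousOn_update_iff]
    constructor
    · have hi : ContinuousOn (fun s : ℝ => s⁻¹) (S \ {0}) :=
        continuousOn_id.inv₀ (fun x hx => hx.2)
      exact (((hi.smul (hcc.mono sdiff_subset)).clm_apply (hγ1.2.mono sdiff_subset))).const_smul _
    · intro _
      have h1 := hasDerivWithinAt_iff_tendsto_slope.1 hcd
      have h2 : Filter.Tendsto (derivWithin γ S) (nhdsWithin 0 (S \ {0})) (nhds v) :=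
        (hγ1.2 0 h0S).mono_left (nhdsWithin_mono _ sdiff_subset)
      have h3 := (((isBoundedBilinearMap_apply (𝕜 := ℝ) (E := E) (F := F)).continuous.tendsto _).comp
        (Filter.Tendsto.prodMk_nhds h1 h2)).const_smul (2⁻¹ : ℝ)
      refine h3.congr (fun s => ?_)
      simp [slope, hc0, hh0]
  have hsq : MapsTo Real.sqrt (Icc 0 (r ^ 2)) S := fun t ht =>
    ⟨Real.sqrt_nonneg t, Real.sqrt_le_iff.2 ⟨hr.le, ht.2⟩⟩
  have hcont2 : ContinuousOn (fun t => h (Real.sqrt t)) (Icc 0 (r ^ 2)) :=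
    hcont.comp Real.continuous_sqrt.continuousOn hsq
  set η : ℝ → F := fun t => f (γ (Real.sqrt t)) with hη
  have hηc : ContinuousOn η (Icc 0 (r ^ 2)) :=
    (hf.continuousOn.comp hγ.continuousOn hγU).comp Real.continuous_sqrt.continuousOn hsq
  have hpos : ∀ t ∈ Icc 0 (r ^ 2), t ≠ 0 →
      HasDerivWithinAt η (h (Real.sqrt t)) (Icc 0 (r ^ 2)) t := by
    intro t ht ht0
    have hst : Real.sqrt t ≠ 0 := by
      rw [Real.sqrt_ne_zero ht.1]; exact ht0
    have h1 : HasDerivWithinAt (fun s => f (γ s)) (c (Real.sqrt t) (derivWithin γ S (Real.sqrt t)))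
        S (Real.sqrt t) :=
      (hfd _ (hγU (hsq ht))).comp_hasDerivWithinAt _ (hγd _ (hsq ht))
    have h2 := h1.scomp t (Real.hasDerivAt_sqrt ht0).hasDerivWithinAt hsq
    change HasDerivWithinAt η _ _ _ at h2
    convert h2 using 1
    rw [hh, Function.update_of_ne hst]
    simp [hh0, smul_smul]
    congr 1
    ring
  have hzero : HasDerivWithinAt η (h (Real.sqrt 0)) (Icc 0 (r ^ 2)) 0 := by
    have hIoo : ∀ t ∈ Ioo 0 (r ^ 2), HasDerivAt η (h (Real.sqrt t)) t := fun t ht =>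
      (hpos t (Ioo_subset_Icc_self ht) ht.1.ne').hasDerivAt (Icc_mem_nhds ht.1 ht.2)
    have hmem : Ioo 0 (r ^ 2) ∈ nhdsWithin (0:ℝ) (Ioi 0) := Ioo_mem_nhdsGT hr2
    refine (hasDerivWithinAt_Ici_of_tendsto_deriv (s := Ioo 0 (r ^ 2))
      (fun t ht => (hIoo t ht).differentiableAt.differentiableWithinAt)
      ((hηc 0 ⟨le_refl _, hr2.le⟩).mono Ioo_subset_Icc_self) hmem ?_).mono Icc_subset_Ici_self
    have h1 : Filter.Tendsto (fun t => h (Real.sqrt t)) (nhdsWithin 0 (Ioi 0))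
        (nhds (h (Real.sqrt 0))) := by
      rw [← nhdsWithin_Ioo_eq_nhdsGT hr2]
      exact (hcont2 0 ⟨le_refl _, hr2.le⟩).mono_left (nhdsWithin_mono _ Ioo_subset_Icc_self)
    refine h1.congr' ?_
    filter_upwards [hmem] with t ht using (hIoo t ht).deriv.symm
  have hall : ∀ t ∈ Icc 0 (r ^ 2),
      HasDerivWithinAt η (h (Real.sqrt t)) (Icc 0 (r ^ 2)) t := by
    intro t ht
    by_cases ht0 : t = 0
    · subst ht0; exact hzero
    · exact hpos t ht ht0
  constructor
  · rw [contDiffOn_one_iff_derivWithin hudT]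
    exact ⟨fun t ht => (hall t ht).differentiableWithinAt,
      hcont2.congr fun t ht => (hall t ht).derivWithin (hudT t ht)⟩
  · rw [hzero.derivWithin (hudT 0 ⟨le_refl _, hr2.le⟩), iteratedFDeriv_two_apply]
    simp [hh, hd]
end

section
/- Let A be a real unital Banach algebra, r > 0, and γ₁, γ₂ : ℝ → A maps that are C¹ on [0,r] with γ₁(0) = γ₂(0) = 1 and such that γ₁(t) and γ₂(t) are invertible in A for all t ∈ [0,r]. Then the commutator curve η : [0,r²] → A, η(t) := γ₁(√t)·γ₂(√t)·γ₁(√t)⁻¹·γ₂(√t)⁻¹, is C¹ on [0,r²], and its right-sided derivative at 0 equals the ring commutator γ₁'(0)·γ₂'(0) − γ₂'(0)·γ₁'(0), where γᵢ'(0) denotes the right-sided derivative of γᵢ at 0. -/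
open Set

lemma slope_aux {A : Type*} [NormedRing A] [NormedAlgebra ℝ A] (r : ℝ) (hr : 0 < r)
    (γ : ℝ → A) (h : ContDiffOn ℝ 1 γ (Icc 0 r)) (h0 : γ 0 = 1) :
    ∃ p : ℝ → A, ContinuousOn p (Icc 0 r) ∧ p 0 = derivWithin γ (Icc 0 r) 0 ∧
      ∀ s, γ s = 1 + s • p s := by
  classical
  refine ⟨Function.update (slope γ 0) 0 (derivWithin γ (Icc 0 r) 0), ?_, by simp, ?_⟩
  · rw [continuousOn_update_iff]
    constructor
    · have : ContinuousOn (fun s : ℝ => (s - 0)⁻¹ • (γ s - γ 0)) (Icc 0 r \ {0}) := by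
        apply ContinuousOn.smul
        · apply ContinuousOn.inv₀
          · fun_prop
          · intro x hx
            simpa using hx.2
        · exact (h.continuousOn.mono diff_subset).sub continuousOn_const
      exact this
    · intro hx
      rw [← hasDerivWithinAt_iff_tendsto_slope]
      exact ((h.differentiableOn one_ne_zero) 0 hx).hasDerivWithinAt
  · intro s
    by_cases hs : s = 0
    · subst hs; simp [h0]
    · rw [Function.update_of_ne hs, slope_def_module, smul_smul, sub_zero, mul_inv_cancel₀ hs, h0]
      simp

lemma inv_aux {A : Type*} [NormedRing A] [NormedAlgebra ℝ A] [CompleteSpace A] (r : ℝ)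
    (γ : ℝ → A) (h : ContDiffOn ℝ 1 γ (Icc 0 r))
    (hu : ∀ t ∈ Icc (0:ℝ) r, IsUnit (γ t)) :
    ContDiffOn ℝ 1 (fun s => Ring.inverse (γ s)) (Icc 0 r) := by
  intro t ht
  obtain ⟨u, hu'⟩ := hu t ht
  have := contDiffAt_ringInverse ℝ (n := 1) u
  rw [hu'] at this
  exact this.comp_contDiffWithinAt t (h t ht)

theorem stmt11
    {A : Type*} [NormedRing A] [NormedAlgebra ℝ A] [CompleteSpace A]
    (r : ℝ) (hr : 0 < r)
    (γ₁ γ₂ : ℝ → A)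
    (h₁ : ContDiffOn ℝ 1 γ₁ (Icc 0 r)) (h₂ : ContDiffOn ℝ 1 γ₂ (Icc 0 r))
    (h₁0 : γ₁ 0 = 1) (h₂0 : γ₂ 0 = 1)
    (hu₁ : ∀ t ∈ Icc (0:ℝ) r, IsUnit (γ₁ t)) (hu₂ : ∀ t ∈ Icc (0:ℝ) r, IsUnit (γ₂ t)) :
    ContDiffOn ℝ 1
      (fun t => γ₁ (Real.sqrt t) * γ₂ (Real.sqrt t) *
        Ring.inverse (γ₁ (Real.sqrt t)) * Ring.inverse (γ₂ (Real.sqrt t)))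
      (Icc 0 (r ^ 2)) ∧
    derivWithin
      (fun t => γ₁ (Real.sqrt t) * γ₂ (Real.sqrt t) *
        Ring.inverse (γ₁ (Real.sqrt t)) * Ring.inverse (γ₂ (Real.sqrt t)))
      (Icc 0 (r ^ 2)) 0 =
      derivWithin γ₁ (Icc 0 r) 0 * derivWithin γ₂ (Icc 0 r) 0 -
        derivWithin γ₂ (Icc 0 r) 0 * derivWithin γ₁ (Icc 0 r) 0 := by
  obtain ⟨p, hpc, hp0, hp⟩ := slope_aux r hr γ₁ h₁ h₁0
  obtain ⟨q, hqc, hq0, hq⟩ := slope_aux r hr γ₂ h₂ h₂0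
  have hr2 : (0:ℝ) < r ^ 2 := by positivity
  have hI : UniqueDiffOn ℝ (Icc 0 r) := uniqueDiffOn_Icc hr
  have hJ : UniqueDiffOn ℝ (Icc 0 (r ^ 2)) := uniqueDiffOn_Icc hr2
  set u : ℝ → A := fun s => Ring.inverse (γ₁ s) * Ring.inverse (γ₂ s) with hu
  have huC : ContDiffOn ℝ 1 u (Icc 0 r) := (inv_aux r γ₁ h₁ hu₁).mul (inv_aux r γ₂ h₂ hu₂)
  set a' := derivWithin γ₁ (Icc 0 r) with ha'
  set b' := derivWithin γ₂ (Icc 0 r) with hb'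
  set u' := derivWithin u (Icc 0 r) with hu'
  have ha'c : ContinuousOn a' (Icc 0 r) := h₁.continuousOn_derivWithin hI le_rfl
  have hb'c : ContinuousOn b' (Icc 0 r) := h₂.continuousOn_derivWithin hI le_rfl
  have hu'c : ContinuousOn u' (Icc 0 r) := huC.continuousOn_derivWithin hI le_rfl
  have huc := huC.continuousOn
  have hu0 : u 0 = 1 := by simp [hu, h₁0, h₂0]
  have hmaps : MapsTo Real.sqrt (Icc 0 (r ^ 2)) (Icc 0 r) := fun t ht =>
    ⟨Real.sqrt_nonneg t, Real.sqrt_le_iff.2 ⟨hr.le, ht.2⟩⟩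
  set F : ℝ → A := (fun t => γ₁ (Real.sqrt t) * γ₂ (Real.sqrt t) *
        Ring.inverse (γ₁ (Real.sqrt t)) * Ring.inverse (γ₂ (Real.sqrt t))) with hF
  -- the commutator in product form
  have hη : ∀ s ∈ Icc 0 r, γ₁ s * γ₂ s * Ring.inverse (γ₁ s) * Ring.inverse (γ₂ s) =
      1 + (γ₁ s * γ₂ s - γ₂ s * γ₁ s) * u s := by
    intro s hs
    have e1 := Ring.mul_inverse_cancel _ (hu₁ s hs)
    have e2 := Ring.mul_inverse_cancel _ (hu₂ s hs)
    have : γ₂ s * γ₁ s * u s = 1 := by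
      rw [hu]
      calc γ₂ s * γ₁ s * (Ring.inverse (γ₁ s) * Ring.inverse (γ₂ s))
          = γ₂ s * (γ₁ s * Ring.inverse (γ₁ s)) * Ring.inverse (γ₂ s) := by
            simp only [mul_assoc]
        _ = 1 := by rw [e1, mul_one, e2]
    rw [sub_mul, this, hu]
    simp only [mul_assoc]
    abel
  let c : ℝ → A := fun s => p s * q s - q s * p s
  have hcc : ContinuousOn c (Icc 0 r) := (hpc.mul hqc).sub (hqc.mul hpc)
  have hc : ∀ s, γ₁ s * γ₂ s - γ₂ s * γ₁ s = (s ^ 2) • c s := by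
    intro s
    simp only [c, hp s, hq s, mul_add, add_mul, smul_mul_assoc, mul_smul_comm, mul_one, one_mul]
    module
  let D : ℝ → A := fun s =>
    (1 / 2 : ℝ) • ((a' s * q s - q s * a' s + (p s * b' s - b' s * p s)) * u s
      + s • (c s * u' s))
  have hDc : ContinuousOn D (Icc 0 r) := by
    apply ContinuousOn.const_smul
    exact ((((ha'c.mul hqc).sub (hqc.mul ha'c)).add ((hpc.mul hb'c).sub (hb'c.mul hpc))).mul
      huc).add (continuousOn_id.smul (hcc.mul hu'c))
  have hD0 : D 0 = a' 0 * b' 0 - b' 0 * a' 0 := by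
    simp only [D, hp0, hq0, hu0, zero_smul, add_zero, mul_one]
    module
  have hder : ∀ t ∈ Icc 0 (r ^ 2), HasDerivWithinAt F (D (Real.sqrt t)) (Icc 0 (r ^ 2)) t := by
    intro t ht
    have hs := hmaps ht
    rcases ht.1.eq_or_lt with h0 | hpos
    · subst h0
      rw [Real.sqrt_zero, hD0, hasDerivWithinAt_iff_tendsto_slope]
      have hK : ContinuousOn (fun t => c (Real.sqrt t) * u (Real.sqrt t)) (Icc 0 (r ^ 2)) :=
        (hcc.mul huc).comp Real.continuous_sqrt.continuousOn hmaps
      have h3 := (hK 0 ht).tendsto.mono_left (nhdsWithin_mono 0 (diff_subset (t := {0})))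
      have e0 : c (Real.sqrt 0) * u (Real.sqrt 0) = a' 0 * b' 0 - b' 0 * a' 0 := by
        simp [c, hp0, hq0, hu0]
      rw [e0] at h3
      refine h3.congr' ?_
      filter_upwards [self_mem_nhdsWithin] with x hx
      have hx0 : x ≠ 0 := hx.2
      have hF0 : F 0 = 1 := by simp [hF, h₁0, h₂0]
      have hFx : F x = 1 + x • (c (Real.sqrt x) * u (Real.sqrt x)) := by
        rw [hF]
        simp only
        rw [hη _ (hmaps hx.1), hc, Real.sq_sqrt hx.1.1, smul_mul_assoc]
      rw [slope_def_module, hFx, hF0, add_sub_cancel_left, sub_zero, smul_smul,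
        inv_mul_cancel₀ hx0, one_smul]
    · have hsp : 0 < Real.sqrt t := Real.sqrt_pos.2 hpos
      have hsq := (Real.hasDerivAt_sqrt hpos.ne').hasDerivWithinAt (s := Icc 0 (r ^ 2))
      generalize hst : Real.sqrt t = s at *
      have d1 : HasDerivWithinAt γ₁ (a' s) (Icc 0 r) s :=
        ((h₁.differentiableOn one_ne_zero) s hs).hasDerivWithinAt
      have d2 : HasDerivWithinAt γ₂ (b' s) (Icc 0 r) s :=
        ((h₂.differentiableOn one_ne_zero) s hs).hasDerivWithinAt
      have d3 : HasDerivWithinAt u (u' s) (Icc 0 r) s :=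
        ((huC.differentiableOn one_ne_zero) s hs).hasDerivWithinAt
      have d4 := (((d1.mul d2).sub (d2.mul d1)).mul d3).const_add 1
      rw [← hst] at d4
      have d5 := d4.scomp t hsq hmaps
      rw [hst] at d5
      refine (d5.congr_deriv ?_).congr_of_mem ?_ ht
      · have e : (γ₁ * γ₂ - γ₂ * γ₁) s = (s ^ 2) • c s := hc s
        have e' : a' s * γ₂ s + γ₁ s * b' s - (b' s * γ₁ s + γ₂ s * a' s) =
            s • (a' s * q s - q s * a' s + (p s * b' s - b' s * p s)) := by
          simp only [hp s, hq s, mul_add, add_mul, smul_mul_assoc, mul_smul_comm, mul_one, one_mul]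
          module
        rw [e, e']
        simp only [D, smul_mul_assoc]
        match_scalars <;> field_simp
      · intro x hx
        exact hη _ (hmaps hx)
  have hdw : ∀ t ∈ Icc 0 (r ^ 2), derivWithin F (Icc 0 (r ^ 2)) t = D (Real.sqrt t) :=
    fun t ht => (hder t ht).derivWithin (hJ t ht)
  refine ⟨?_, ?_⟩
  · rw [show (1 : WithTop ℕ∞) = 0 + 1 by simp, contDiffOn_succ_iff_derivWithin hJ]
    refine ⟨fun t ht => (hder t ht).differentiableWithinAt, by simp, ?_⟩
    rw [contDiffOn_zero]
    exact (hDc.comp Real.continuous_sqrt.continuousOn hmaps).congr hdw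
  · rw [hdw 0 ⟨le_rfl, hr2.le⟩, Real.sqrt_zero, hD0]
end

section
/- Let E be a real Banach space, F ⊆ E a closed vector subspace, a < b real numbers, and γ : [a,b] → E Bochner integrable with respect to Lebesgue measure. Then ∫_a^t γ(s) ds ∈ F for all t ∈ [a,b] if and only if γ(t) ∈ F for Lebesgue-almost every t ∈ [a,b]. -/
open MeasureTheory Set

theorem stmt13
    {E : Type*} [NormedAddCommGroup E] [NormedSpace ℝ E] [CompleteSpace E]
    (F : Submodule ℝ E) (hF : IsClosed (F : Set E))
    (a b : ℝ) (hab : a < b)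
    (γ : ℝ → E) (hγ : IntegrableOn γ (Icc a b) volume) :
    (∀ t ∈ Icc a b, (∫ s in a..t, γ s) ∈ F) ↔
      (∀ᵐ t ∂(volume.restrict (Icc a b)), γ t ∈ F) := by
  have : IsClosed (F : Set E) := hF
  have : CompleteSpace (E ⧸ F) := inferInstance
  have key : ∀ x, x ∈ F ↔ F.mkQL x = 0 := fun x => by simp
  have hint : IntervalIntegrable γ volume a b :=
    (intervalIntegrable_iff_integrableOn_Icc_of_le hab.le).2 hγ
  have hsub : ∀ t ∈ Icc a b, IntervalIntegrable γ volume a t := fun t ht =>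
    hint.mono_set (by rw [uIcc_of_le hab.le, uIcc_of_le ht.1]; exact Icc_subset_Icc_right ht.2)
  have hcomm : ∀ t ∈ Icc a b, F.mkQL (∫ s in a..t, γ s) = ∫ s in a..t, F.mkQL (γ s) :=
    fun t ht => (F.mkQL.intervalIntegral_comp_comm (hsub t ht)).symm
  simp only [key]
  constructor
  · intro h
    rw [ae_restrict_iff' measurableSet_Icc]
    have h₁ : ∀ᵐ x : ℝ, x ≠ a := by simp [ae_iff, measure_singleton]
    have h₂ : ∀ᵐ x : ℝ, x ≠ b := by simp [ae_iff, measure_singleton]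
    filter_upwards [hint.ae_hasDerivAt_integral, h₁, h₂] with t hd hta htb ht
    rw [uIcc_of_le hab.le] at hd
    have hd1 := F.mkQL.hasFDerivAt.comp_hasDerivAt t (hd ht a ⟨le_rfl, hab.le⟩)
    refine hd1.unique ((hasDerivAt_const t (0 : E ⧸ F)).congr_of_eventuallyEq ?_)
    filter_upwards [Icc_mem_nhds (lt_of_le_of_ne ht.1 hta.symm) (lt_of_le_of_ne ht.2 htb)]
      with x hx
    exact h x hx
  · intro h t ht
    rw [hcomm t ht]
    apply intervalIntegral.integral_zero_ae
    rw [ae_restrict_iff' measurableSet_Icc] at h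
    filter_upwards [h] with s hs hs'
    rw [uIoc_of_le ht.1] at hs'
    exact hs ⟨hs'.1.le, hs'.2.trans ht.2⟩
end

section
/- Let E be a real normed space, a < b real numbers, and γ : [a,b] → E a regulated function, i.e. there exists a sequence of step functions [a,b] → E converging uniformly to γ. Then there exists a sequence (γ_n) of step functions converging uniformly to γ that additionally satisfies γ_n([a,b]) ⊆ γ([a,b]) for all n. -/
open Set Filter

/-- `f` is a step function on `[a,b]`: there is a partition
`a = t 0 < t 1 < ⋯ < t m = b` such that `f` is constant on each open
subinterval `(t (j-1), t j)`. -/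
def IsStepOn {E : Type*} (a b : ℝ) (f : ℝ → E) : Prop :=
  ∃ (m : ℕ) (t : Fin (m + 1) → ℝ), StrictMono t ∧ t 0 = a ∧ t (Fin.last m) = b ∧
    ∀ j : Fin m, ∀ x ∈ Ioo (t j.castSucc) (t j.succ), ∀ y ∈ Ioo (t j.castSucc) (t j.succ),
      f x = f y

theorem stmt14
    {E : Type*} [NormedAddCommGroup E] [NormedSpace ℝ E]
    (a b : ℝ) (hab : a < b) (γ : ℝ → E)
    (hreg : ∃ s : ℕ → ℝ → E, (∀ n, IsStepOn a b (s n)) ∧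
      TendstoUniformlyOn s γ atTop (Icc a b)) :
    ∃ s : ℕ → ℝ → E, (∀ n, IsStepOn a b (s n)) ∧
      TendstoUniformlyOn s γ atTop (Icc a b) ∧
      ∀ n, s n '' Icc a b ⊆ γ '' Icc a b := by
  obtain ⟨s, hs, hu⟩ := hreg
  have key : ∀ n, ∀ x ∈ Icc a b, Function.invFunOn (s n) (Icc a b) (s n x) ∈ Icc a b ∧
      s n (Function.invFunOn (s n) (Icc a b) (s n x)) = s n x := fun n x hx =>
    ⟨Function.invFunOn_mem ⟨x, hx, rfl⟩, Function.invFunOn_eq ⟨x, hx, rfl⟩⟩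
  refine ⟨fun n x => γ (Function.invFunOn (s n) (Icc a b) (s n x)), ?_, ?_, ?_⟩
  · intro n
    obtain ⟨m, t, h1, h2, h3, h4⟩ := hs n
    refine ⟨m, t, h1, h2, h3, fun j x hx y hy => ?_⟩
    simp only [h4 j x hx y hy]
  · rw [Metric.tendstoUniformlyOn_iff] at hu ⊢
    intro ε hε
    filter_upwards [hu (ε / 2) (half_pos hε)] with n hn x hx
    obtain ⟨hz, he⟩ := key n x hx
    have d1 := hn x hx
    have d2 := hn _ hz
    rw [he, dist_comm] at d2
    have := dist_triangle (γ x) (s n x) (γ (Function.invFunOn (s n) (Icc a b) (s n x)))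
    linarith
  · rintro n _ ⟨x, hx, rfl⟩
    exact ⟨_, (key n x hx).1, rfl⟩
end

section
/- Let n, m ≥ 1 be integers and let γ : [0,1] → BC(ℝⁿ, ℝᵐ) be Bochner integrable with respect to Lebesgue measure on [0,1], where BC(ℝⁿ,ℝᵐ) denotes the Banach space of bounded continuous functions ℝⁿ → ℝᵐ with the supremum norm. Then the map (t,x) ↦ γ(t)(x) is Borel measurable on [0,1] × ℝⁿ, and for every Borel measurable ζ : [0,1] → ℝⁿ the function t ↦ γ(t)(ζ(t)) is Bochner integrable with ∫₀¹ ‖γ(t)(ζ(t))‖ dt ≤ ∫₀¹ ‖γ(t)‖_∞ dt. -/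
open MeasureTheory Set

attribute [local instance] MeasureTheory.Measure.Subtype.measureSpace

theorem stmt15
    (n m : ℕ) (hn : 1 ≤ n) (hm : 1 ≤ m)
    (γ : Icc (0:ℝ) 1 → BoundedContinuousFunction (Fin n → ℝ) (Fin m → ℝ))
    (hγm : StronglyMeasurable γ)
    (hγi : Integrable γ volume) :
    Measurable (fun q : Icc (0:ℝ) 1 × (Fin n → ℝ) => γ q.1 q.2) ∧
    ∀ ζ : Icc (0:ℝ) 1 → (Fin n → ℝ), Measurable ζ →
      Integrable (fun t => γ t (ζ t)) volume ∧
      (∫ t, ‖γ t (ζ t)‖) ≤ ∫ t, ‖γ t‖ := by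
  have hM : Measurable (fun q : Icc (0:ℝ) 1 × (Fin n → ℝ) => γ q.1 q.2) := by
    have h1 : StronglyMeasurable (fun q : Icc (0:ℝ) 1 × (Fin n → ℝ) => (γ q.1, q.2)) :=
      (hγm.comp_measurable measurable_fst).prodMk measurable_snd.stronglyMeasurable
    have hc : Continuous (fun p : BoundedContinuousFunction (Fin n → ℝ) (Fin m → ℝ) ×
        (Fin n → ℝ) => p.1 p.2) := by
      fun_prop
    exact (hc.comp_stronglyMeasurable h1).measurable
  refine ⟨hM, fun ζ hζ => ?_⟩
  have hm' : Measurable (fun t => γ t (ζ t)) := hM.comp (measurable_id.prodMk hζ)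
  have hb : ∀ t, ‖γ t (ζ t)‖ ≤ ‖γ t‖ := fun t => (γ t).norm_coe_le_norm (ζ t)
  have hI : Integrable (fun t => γ t (ζ t)) volume :=
    hγi.mono hm'.aestronglyMeasurable (Filter.Eventually.of_forall hb)
  exact ⟨hI, integral_mono hI.norm hγi.norm hb⟩
end

section
/- Let E₁, E₂, F be real normed spaces, V ⊆ E₁ open, and f : V × E₂ → F a C¹-map such that f(x,·) : E₂ → F is linear for every x ∈ V. Let K ⊆ V be compact. Then there exist ε > 0 and C ≥ 0 such that the open ε-neighbourhood K_ε := {z ∈ E₁ : dist(z,K) < ε} is contained in V and ‖f(z,v) − f(y,w)‖ ≤ C·(‖v − w‖ + ‖z − y‖·‖w‖) for all z, y ∈ K_ε and all v, w ∈ E₂. -/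
open Set Metric

theorem stmt16_local
    {E₁ : Type*} [NormedAddCommGroup E₁] [NormedSpace ℝ E₁]
    {E₂ : Type*} [NormedAddCommGroup E₂] [NormedSpace ℝ E₂]
    {F : Type*} [NormedAddCommGroup F] [NormedSpace ℝ F]
    (V : Set E₁) (hV : IsOpen V)
    (f : E₁ → E₂ → F)
    (hf : ContDiffOn ℝ 1 (fun q : E₁ × E₂ => f q.1 q.2) (V ×ˢ (univ : Set E₂)))
    (hf_lin : ∀ x ∈ V, IsLinearMap ℝ (f x)) (x : E₁) (hx : x ∈ V) :
    ∃ M : ℝ, ∃ r : ℝ, 0 ≤ M ∧ 0 < r ∧ ball x r ⊆ V ∧ ∀ z ∈ ball x r, ∀ y ∈ ball x r, ∀ w : E₂,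
      ‖f z w - f y w‖ ≤ M * (‖z - y‖ * ‖w‖) ∧ ‖f z w‖ ≤ M * ‖w‖ := by
  have h1 : ContDiffAt ℝ 1 (fun q : E₁ × E₂ => f q.1 q.2) (x, 0) :=
    hf.contDiffAt ((hV.prod isOpen_univ).mem_nhds ⟨hx, mem_univ _⟩)
  obtain ⟨L, t, ht, hL⟩ := h1.exists_lipschitzOnWith
  obtain ⟨r, hr, hrt⟩ := Metric.mem_nhds_iff.1 ht
  obtain ⟨r', hr', hrV⟩ := Metric.isOpen_iff.1 hV x hx
  have key : ∀ z ∈ ball x (min r r'), ∀ w : E₂, w ≠ 0 →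
      (z, (r / 2 / ‖w‖) • w) ∈ t ∧ (z, (0 : E₂)) ∈ t ∧
      f z ((r / 2 / ‖w‖) • w) = (r / 2 / ‖w‖) • f z w ∧ f z 0 = 0 := by
    intro z hz w hw
    have hz1 : dist z x < r := lt_of_lt_of_le hz (min_le_left _ _)
    have hzV : z ∈ V := hrV (ball_subset_ball (min_le_right _ _) hz)
    have hw0 : 0 < ‖w‖ := norm_pos_iff.2 hw
    refine ⟨hrt ?_, hrt ?_, (hf_lin z hzV).map_smul _ _, (hf_lin z hzV).map_zero⟩
    · rw [mem_ball, Prod.dist_eq, max_lt_iff]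
      refine ⟨hz1, ?_⟩
      simp only [dist_zero_right, norm_smul, Real.norm_eq_abs]
      rw [abs_of_pos (by positivity)]
      field_simp
      linarith
    · rw [mem_ball, Prod.dist_eq, max_lt_iff]
      exact ⟨hz1, by simpa using hr⟩
  refine ⟨L * (2 / r) + L, min r r', by positivity, lt_min hr hr',
    (ball_subset_ball (min_le_right _ _)).trans hrV, ?_⟩
  intro z hz y hy w
  have hzV : z ∈ V := hrV (ball_subset_ball (min_le_right _ _) hz)
  have hyV : y ∈ V := hrV (ball_subset_ball (min_le_right _ _) hy)
  rcases eq_or_ne w 0 with rfl | hw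
  · simp [(hf_lin z hzV).map_zero, (hf_lin y hyV).map_zero]
  have hw0 : 0 < ‖w‖ := norm_pos_iff.2 hw
  obtain ⟨a1, a2, a3, a4⟩ := key z hz w hw
  obtain ⟨b1, b2, b3, b4⟩ := key y hy w hw
  have c1 := hL.dist_le_mul _ a1 _ b1
  have c2 := hL.dist_le_mul _ a1 _ a2
  have hs : 0 < r / 2 / ‖w‖ := by positivity
  simp only [a3, b3, a4, dist_eq_norm, ← smul_sub, Prod.mk_sub_mk, sub_self, sub_zero,
    Prod.norm_mk, norm_zero, norm_smul, Real.norm_eq_abs, abs_of_pos hs] at c1 c2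
  rw [max_eq_left (norm_nonneg _)] at c1
  rw [max_eq_right (by positivity)] at c2
  have hLn : (0 : ℝ) ≤ L := L.2
  constructor
  · have : ‖f z w - f y w‖ ≤ L * (2 / r) * (‖z - y‖ * ‖w‖) := by
      rw [← mul_le_mul_iff_right₀ hs]
      refine c1.trans (le_of_eq ?_)
      field_simp
    nlinarith [mul_nonneg hLn (mul_nonneg (norm_nonneg (z - y)) hw0.le)]
  · have : ‖f z w‖ ≤ L * ‖w‖ := by
      rw [← mul_le_mul_iff_right₀ hs]
      refine c2.trans (le_of_eq ?_)
      ring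
    have : 0 ≤ L * (2 / r) * ‖w‖ := by positivity
    linarith

theorem stmt16
    {E₁ : Type*} [NormedAddCommGroup E₁] [NormedSpace ℝ E₁]
    {E₂ : Type*} [NormedAddCommGroup E₂] [NormedSpace ℝ E₂]
    {F : Type*} [NormedAddCommGroup F] [NormedSpace ℝ F]
    (V : Set E₁) (hV : IsOpen V)
    (f : E₁ → E₂ → F)
    (hf : ContDiffOn ℝ 1 (fun q : E₁ × E₂ => f q.1 q.2) (V ×ˢ (univ : Set E₂)))
    (hf_lin : ∀ x ∈ V, IsLinearMap ℝ (f x))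
    (K : Set E₁) (hK : IsCompact K) (hKV : K ⊆ V) :
    ∃ ε : ℝ, 0 < ε ∧ ∃ C : ℝ, 0 ≤ C ∧
      thickening ε K ⊆ V ∧
      ∀ z ∈ thickening ε K, ∀ y ∈ thickening ε K, ∀ v w : E₂,
        ‖f z v - f y w‖ ≤ C * (‖v - w‖ + ‖z - y‖ * ‖w‖) := by
  have loc := fun x : V => stmt16_local V hV f hf hf_lin x.1 x.2
  choose M r hM hr hrV hP using loc
  obtain ⟨t, ht⟩ := hK.elim_finite_subcover (fun x : V => ball x.1 (r x)) (fun _ => isOpen_ball)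
    (fun x hx => mem_iUnion.2 ⟨⟨x, hKV hx⟩, mem_ball_self (hr _)⟩)
  obtain ⟨δ, hδ, hleb⟩ := lebesgue_number_lemma_of_metric (c := fun i : t => ball i.1.1 (r i.1)) hK
    (fun _ => isOpen_ball) (by
      intro x hx
      obtain ⟨i, hi, hxi⟩ := mem_iUnion₂.1 (ht hx)
      exact mem_iUnion.2 ⟨⟨i, hi⟩, hxi⟩)
  set A : ℝ := ∑ i ∈ t, M i with hA
  have hA0 : 0 ≤ A := Finset.sum_nonneg fun i _ => hM i
  have hMA : ∀ i ∈ t, M i ≤ A := fun i hi => Finset.single_le_sum (fun i _ => hM i) hi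
  have hball : ∀ x ∈ K, ball x δ ⊆ V ∧ ∀ z ∈ ball x δ, ∀ y ∈ ball x δ, ∀ w : E₂,
      ‖f z w - f y w‖ ≤ A * (‖z - y‖ * ‖w‖) ∧ ‖f z w‖ ≤ A * ‖w‖ := by
    intro x hx
    obtain ⟨⟨i, hi⟩, hsub⟩ := hleb x hx
    refine ⟨hsub.trans (hrV i), fun z hz y hy w => ?_⟩
    obtain ⟨h1, h2⟩ := hP i z (hsub hz) y (hsub hy) w
    exact ⟨h1.trans (mul_le_mul_of_nonneg_right (hMA i hi) (by positivity)),
      h2.trans (mul_le_mul_of_nonneg_right (hMA i hi) (by positivity))⟩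
  have hth : ∀ z ∈ thickening (δ / 2) K, ∃ x ∈ K, dist z x < δ / 2 := fun z hz =>
    mem_thickening_iff.1 hz
  have hb : ∀ z ∈ thickening (δ / 2) K, z ∈ V ∧ ∀ w, ‖f z w‖ ≤ A * ‖w‖ := by
    intro z hz
    obtain ⟨x, hx, hzx⟩ := hth z hz
    have hzb : z ∈ ball x δ := by rw [mem_ball]; linarith
    exact ⟨(hball x hx).1 hzb, fun w => ((hball x hx).2 z hzb z hzb w).2⟩
  refine ⟨δ / 2, by positivity, A + A * (4 / δ), by positivity, fun z hz => (hb z hz).1, ?_⟩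
  intro z hz y hy v w
  have e1 : ‖f z (v - w)‖ ≤ A * ‖v - w‖ := (hb z hz).2 _
  have e2 : ‖f z w - f y w‖ ≤ (A + A * (4 / δ)) * (‖z - y‖ * ‖w‖) := by
    rcases lt_or_ge ‖z - y‖ (δ / 2) with h | h
    · obtain ⟨x, hx, hzx⟩ := hth z hz
      have hzb : z ∈ ball x δ := by rw [mem_ball]; linarith
      have hyb : y ∈ ball x δ := by
        rw [mem_ball]
        have := dist_triangle_left y x z
        rw [dist_eq_norm z y] at this
        linarith
      refine ((hball x hx).2 z hzb y hyb w).1.trans ?_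
      exact mul_le_mul_of_nonneg_right (le_add_of_nonneg_right (by positivity)) (by positivity)
    · have g1 := (hb z hz).2 w
      have g2 := (hb y hy).2 w
      have g3 := norm_sub_le (f z w) (f y w)
      have g4 : A * (4 / δ) * (δ / 2 * ‖w‖) ≤ A * (4 / δ) * (‖z - y‖ * ‖w‖) := by gcongr
      have g5 : A * (4 / δ) * (δ / 2 * ‖w‖) = 2 * (A * ‖w‖) := by field_simp; ring
      have g6 : 0 ≤ A * (‖z - y‖ * ‖w‖) := by positivity
      linarith
  have e3 : f z v - f y w = f z (v - w) + (f z w - f y w) := by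
    rw [(hf_lin z (hb z hz).1).map_sub]; abel
  have e4 : 0 ≤ A * (4 / δ) * ‖v - w‖ := by positivity
  rw [e3]
  refine (norm_add_le _ _).trans ?_
  linarith
end

section
/- Let A be a real unital Banach algebra and let γ : [0,1] → A be Bochner integrable with respect to Lebesgue measure. Then there exists a unique continuous map η : [0,1] → A satisfying η(t) = 1 + ∫₀ᵗ η(s)·γ(s) ds for all t ∈ [0,1]; moreover, η(t) is invertible in A for every t ∈ [0,1]. -/
open MeasureTheory Set

theorem ii_of {A : Type*} [NormedRing A] {γ : ℝ → A} (hγ : IntegrableOn γ (Icc 0 1) volume)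
    {a b : ℝ} (ha : 0 ≤ a) (hab : a ≤ b) (hb : b ≤ 1) : IntervalIntegrable γ volume a b := by
  rw [intervalIntegrable_iff_integrableOn_Ioc_of_le hab]
  exact hγ.mono_set (fun x hx => ⟨ha.trans hx.1.le, hx.2.trans hb⟩)

theorem step_induction {A : Type*} [NormedRing A]
    {γ : ℝ → A} (hγ : IntegrableOn γ (Icc 0 1) volume) (P : ℝ → Prop) (c : ℝ) (hc : 0 < c)
    (h0 : P 0)
    (hs : ∀ a b, 0 ≤ a → a ≤ b → b ≤ 1 → (∫ s in a..b, ‖γ s‖) < c → P a → P b) : P 1 := by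
  have hcont : ContinuousOn (fun t => ∫ s in (0:ℝ)..t, ‖γ s‖) (Icc 0 1) := by
    have := intervalIntegral.continuousOn_primitive_interval (a := (0:ℝ)) (b := 1)
      (μ := volume) (f := fun s => ‖γ s‖) (by rw [uIcc_of_le zero_le_one]; exact hγ.norm)
    rwa [uIcc_of_le zero_le_one] at this
  have huc := isCompact_Icc.uniformContinuousOn_of_continuous hcont
  obtain ⟨δ, hδ, H⟩ := Metric.uniformContinuousOn_iff.1 huc c hc
  obtain ⟨N, hN⟩ := exists_nat_one_div_lt hδ
  have hN0 : (0:ℝ) < N + 1 := by positivity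
  have key : ∀ n : ℕ, n ≤ N + 1 → P ((n:ℝ) / (N + 1)) := by
    intro n
    induction n with
    | zero => intro _; simpa using h0
    | succ k ih =>
      intro hk
      have e : (((k+1:ℕ):ℝ)) / (N+1) = (k:ℝ)/(N+1) + 1/(N+1) := by push_cast; ring
      have h1 : (((k+1:ℕ):ℝ)) / (N+1) ≤ 1 := by
        rw [div_le_one hN0]; exact_mod_cast hk
      have h2 : (0:ℝ) ≤ (k:ℝ)/(N+1) := by positivity
      have h3 : (0:ℝ) < 1/((N:ℝ)+1) := by positivity
      have hab : (k:ℝ)/(N+1) ≤ (((k+1:ℕ):ℝ)) / (N+1) := by rw [e]; linarith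
      refine hs _ _ h2 hab h1 ?_ (ih (by omega))
      have := H _ ⟨h2.trans hab, h1⟩ _ ⟨h2, hab.trans h1⟩ (by
        rw [e, Real.dist_eq]; simp only [add_sub_cancel_left]; rw [abs_of_pos h3]; exact hN)
      rw [Real.dist_eq] at this
      rw [intervalIntegral.integral_interval_sub_left] at this
      · exact (le_abs_self _).trans_lt this
      · exact (ii_of hγ le_rfl (h2.trans hab) h1).norm
      · exact (ii_of hγ le_rfl h2 (hab.trans h1)).norm
  have := key (N+1) le_rfl
  push_cast at this
  rwa [div_self hN0.ne'] at this

theorem local_sol {A : Type*} [NormedRing A] [NormedAlgebra ℝ A] [CompleteSpace A]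
    (g : ℝ → A) (hg : Integrable g) (a : ℝ) (hc : (∫ s, ‖g s‖) < 1 / (‖(1:A)‖ + 2)) :
    ∃ u : ℝ → A, Continuous u ∧ (∀ t, u t = 1 + ∫ s in a..t, u s * g s) ∧ ∀ t, IsUnit (u t) := by
  set c := ∫ s, ‖g s‖ with hcdef
  have hc0 : 0 ≤ c := integral_nonneg fun _ => norm_nonneg _
  have hn : 0 ≤ ‖(1:A)‖ := norm_nonneg _
  have hc' : c * (‖(1:A)‖ + 2) < 1 := by rwa [lt_div_iff₀ (by positivity)] at hc
  have hc1 : c < 1 := by nlinarith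
  have hint : ∀ u : BoundedContinuousFunction ℝ A, Integrable (fun s => u s * g s) := fun u =>
    hg.bdd_mul (c := ‖u‖) u.continuous.aestronglyMeasurable
      (Filter.Eventually.of_forall fun x => u.norm_coe_le_norm x)
  have hbd : ∀ (u : BoundedContinuousFunction ℝ A) t, ‖∫ s in a..t, u s * g s‖ ≤ c * ‖u‖ := by
    intro u t
    calc ‖∫ s in a..t, u s * g s‖ ≤ ∫ s in uIoc a t, ‖u s * g s‖ :=
          intervalIntegral.norm_integral_le_integral_norm_uIoc
      _ ≤ ∫ s, ‖u s * g s‖ := setIntegral_le_integral (hint u).norm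
          (Filter.Eventually.of_forall fun x => norm_nonneg _)
      _ ≤ ∫ s, ‖u‖ * ‖g s‖ := integral_mono (hint u).norm (hg.norm.const_mul _) (fun s =>
          (norm_mul_le _ _).trans (mul_le_mul_of_nonneg_right (u.norm_coe_le_norm s) (norm_nonneg _)))
      _ = c * ‖u‖ := by rw [integral_const_mul, mul_comm]
  let T : BoundedContinuousFunction ℝ A → BoundedContinuousFunction ℝ A := fun u =>
    BoundedContinuousFunction.ofNormedAddCommGroup (fun t => 1 + ∫ s in a..t, u s * g s)
      (continuous_const.add (intervalIntegral.continuous_primitive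
        (fun _ _ => (hint u).intervalIntegrable) a))
      (‖(1:A)‖ + c * ‖u‖) (fun t => (norm_add_le _ _).trans (by gcongr; exact hbd u t))
  have hT : ∀ u t, T u t = 1 + ∫ s in a..t, u s * g s := fun u t => rfl
  have hcon : ContractingWith ⟨c, hc0⟩ T := by
    refine ⟨by exact_mod_cast hc1, LipschitzWith.of_dist_le_mul fun u v => ?_⟩
    rw [BoundedContinuousFunction.dist_le (by positivity)]
    intro t
    rw [dist_eq_norm, hT, hT, add_sub_add_left_eq_sub, ← intervalIntegral.integral_sub
      (hint u).intervalIntegrable (hint v).intervalIntegrable, dist_eq_norm]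
    have := hbd (u - v) t
    simp only [BoundedContinuousFunction.coe_sub, Pi.sub_apply, sub_mul] at this
    exact this
  let u := ContractingWith.fixedPoint T hcon
  have hu : T u = u := hcon.fixedPoint_isFixedPt
  have hu' : ∀ t, u t = 1 + ∫ s in a..t, u s * g s := fun t => by rw [← hT, hu]
  refine ⟨u, u.continuous, hu', fun t => ?_⟩
  have hub : ‖u‖ ≤ ‖(1:A)‖ + c * ‖u‖ := by
    rw [BoundedContinuousFunction.norm_le (by positivity)]
    intro t
    rw [hu' t]
    exact (norm_add_le _ _).trans (by gcongr; exact hbd u t)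
  have h1 : ‖1 - u t‖ < 1 := by
    have : 1 - u t = - ∫ s in a..t, u s * g s := by
      conv_lhs => rw [hu' t]
      abel
    rw [this, norm_neg]
    refine (hbd u t).trans_lt ?_
    have h0 := norm_nonneg u
    nlinarith
  have := isUnit_one_sub_of_norm_lt_one h1
  simpa using this

theorem stmt17
    {A : Type*} [NormedRing A] [NormedAlgebra ℝ A] [CompleteSpace A]
    (γ : ℝ → A) (hγ : IntegrableOn γ (Icc 0 1) volume) :
    ∃ η : ℝ → A,
      ContinuousOn η (Icc 0 1) ∧
      (∀ t ∈ Icc (0:ℝ) 1, η t = 1 + ∫ s in (0:ℝ)..t, η s * γ s) ∧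
      (∀ t ∈ Icc (0:ℝ) 1, IsUnit (η t)) ∧
      ∀ η' : ℝ → A, ContinuousOn η' (Icc 0 1) →
        (∀ t ∈ Icc (0:ℝ) 1, η' t = 1 + ∫ s in (0:ℝ)..t, η' s * γ s) →
        EqOn η' η (Icc 0 1) := by
  have hmulint : ∀ (f : ℝ → A), ContinuousOn f (Icc 0 1) → ∀ {a b : ℝ}, 0 ≤ a → a ≤ b → b ≤ 1 →
      IntervalIntegrable (fun s => f s * γ s) volume a b := by
    intro f hf a b ha hab hb
    refine (ii_of hγ ha hab hb).continuousOn_mul (hf.mono ?_)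
    rw [uIcc_of_le hab]
    exact Icc_subset_Icc ha hb
  obtain ⟨η, hη, heq, hun⟩ : ∃ η : ℝ → A, Continuous η ∧
      (∀ t ∈ Icc (0:ℝ) 1, η t = 1 + ∫ s in (0:ℝ)..t, η s * γ s) ∧
      (∀ t ∈ Icc (0:ℝ) 1, IsUnit (η t)) := by
    refine step_induction hγ (fun b => ∃ η : ℝ → A, Continuous η ∧
      (∀ t ∈ Icc (0:ℝ) b, η t = 1 + ∫ s in (0:ℝ)..t, η s * γ s) ∧
      (∀ t ∈ Icc (0:ℝ) b, IsUnit (η t))) (1 / (‖(1:A)‖ + 2)) (by positivity) ?_ ?_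
    · refine ⟨fun _ => 1, continuous_const, ?_, ?_⟩
      · intro t ht
        have : t = 0 := le_antisymm ht.2 ht.1
        simp [this]
      · intro t ht; exact isUnit_one
    · rintro a b ha hab hb hlt ⟨η, hη, heq, hun⟩
      have hgi : IntegrableOn γ (Ioc a b) :=
        (intervalIntegrable_iff_integrableOn_Ioc_of_le hab).1 (ii_of hγ ha hab hb)
      obtain ⟨u, hu, hueq, huun⟩ := local_sol ((Ioc a b).indicator γ)
        (hgi.integrable_indicator measurableSet_Ioc) a (by
          simp_rw [norm_indicator_eq_indicator_norm]
          rw [integral_indicator measurableSet_Ioc, ← intervalIntegral.integral_of_le hab]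
          exact hlt)
      have hua : u a = 1 := by rw [hueq]; simp
      have hle : ∀ t, t ≤ a → η (min t a) * u (max t a) = η t := fun t ht => by
        rw [min_eq_left ht, max_eq_right ht, hua, mul_one]
      have hge : ∀ t, a ≤ t → η (min t a) * u (max t a) = η a * u t := fun t ht => by
        rw [min_eq_right ht, max_eq_left ht]
      have hcn : Continuous fun t => η (min t a) * u (max t a) := by fun_prop
      refine ⟨fun t => η (min t a) * u (max t a), hcn, ?_, ?_⟩
      · have hL : ∀ t, 0 ≤ t → t ≤ a → (∫ s in (0:ℝ)..t, η (min s a) * u (max s a) * γ s)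
            = ∫ s in (0:ℝ)..t, η s * γ s := by
          intro t h0 ht
          refine intervalIntegral.integral_congr fun s hs => ?_
          rw [uIcc_of_le h0] at hs
          rw [hle s (hs.2.trans ht)]
        intro t ht
        rcases le_total t a with h | h
        · simp only
          rw [hL t ht.1 h, hle t h]
          exact heq t ⟨ht.1, h⟩
        · simp only
          rw [hge t h, ← intervalIntegral.integral_add_adjacent_intervals
            (hmulint _ hcn.continuousOn le_rfl ha (hab.trans hb))
            (hmulint _ hcn.continuousOn ha h (ht.2.trans hb)), hL a ha le_rfl, ← add_assoc,
            ← heq a ⟨ha, le_rfl⟩]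
          have e1 : (∫ s in a..t, η (min s a) * u (max s a) * γ s)
              = ∫ s in a..t, η a * (u s * (Ioc a b).indicator γ s) := by
            rw [intervalIntegral.integral_of_le h, intervalIntegral.integral_of_le h]
            refine setIntegral_congr_fun measurableSet_Ioc fun s hs => ?_
            rw [hge s hs.1.le, indicator_of_mem (show s ∈ Ioc a b from ⟨hs.1, hs.2.trans ht.2⟩),
              mul_assoc]
          have hi : IntervalIntegrable (fun s => u s * (Ioc a b).indicator γ s) volume a t :=
            ((hgi.integrable_indicator measurableSet_Ioc).intervalIntegrable).continuousOn_mul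
              hu.continuousOn
          have e2 : (∫ s in a..t, η a * (u s * (Ioc a b).indicator γ s))
              = η a * ∫ s in a..t, (u s * (Ioc a b).indicator γ s) :=
            ((ContinuousLinearMap.mul ℝ A (η a)).intervalIntegral_comp_comm hi)
          rw [e1, e2]
          conv_lhs => rw [hueq t, mul_add, mul_one]
      · intro t ht
        exact (hun _ ⟨le_min ht.1 ha, min_le_right _ _⟩).mul (huun _)
  refine ⟨η, hη.continuousOn, heq, hun, ?_⟩
  intro η' hη' heq'
  have hd : ContinuousOn (fun t => η' t - η t) (Icc 0 1) := hη'.sub hη.continuousOn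
  have hdeq : ∀ t ∈ Icc (0:ℝ) 1, η' t - η t = ∫ s in (0:ℝ)..t, (η' s - η s) * γ s := by
    intro t ht
    simp_rw [sub_mul]
    rw [intervalIntegral.integral_sub (hmulint _ hη' le_rfl ht.1 ht.2)
      (hmulint _ hη.continuousOn le_rfl ht.1 ht.2)]
    conv_lhs => rw [heq t ht, heq' t ht]
    abel
  have main : ∀ t ∈ Icc (0:ℝ) 1, η' t - η t = 0 := by
    refine step_induction hγ (fun b => ∀ t ∈ Icc (0:ℝ) b, η' t - η t = 0) 1 one_pos ?_ ?_
    · intro t ht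
      have : t = 0 := le_antisymm ht.2 ht.1
      subst this
      rw [hdeq 0 ⟨le_rfl, zero_le_one⟩]; simp
    · intro a b ha hab hb hlt hP
      obtain ⟨t₀, ht₀, hmax⟩ := isCompact_Icc.exists_isMaxOn (nonempty_Icc.2 hab)
        (hd.mono (Icc_subset_Icc ha hb)).norm
      have hM : ∀ s ∈ Icc a b, ‖η' s - η s‖ ≤ ‖η' t₀ - η t₀‖ := fun s hs => hmax hs
      have h01 : t₀ ∈ Icc (0:ℝ) 1 := ⟨ha.trans ht₀.1, ht₀.2.trans hb⟩
      have e : η' t₀ - η t₀ = ∫ s in a..t₀, (η' s - η s) * γ s := by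
        have hz := hdeq a ⟨ha, hab.trans hb⟩
        rw [hP a ⟨ha, le_rfl⟩] at hz
        rw [hdeq t₀ h01, ← intervalIntegral.integral_add_adjacent_intervals
          (hmulint _ hd le_rfl ha (hab.trans hb)) (hmulint _ hd ha ht₀.1 h01.2), ← hz, zero_add]
      have hle : ‖η' t₀ - η t₀‖ ≤ ‖η' t₀ - η t₀‖ * ∫ s in a..b, ‖γ s‖ := by
        calc ‖η' t₀ - η t₀‖ = ‖∫ s in a..t₀, (η' s - η s) * γ s‖ := congrArg _ e
          _ ≤ ∫ s in a..t₀, ‖η' t₀ - η t₀‖ * ‖γ s‖ := by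
            refine intervalIntegral.norm_integral_le_of_norm_le ht₀.1
              (Filter.Eventually.of_forall fun s hs => ?_)
              ((ii_of hγ ha ht₀.1 h01.2).norm.const_mul _)
            exact (norm_mul_le _ _).trans (mul_le_mul_of_nonneg_right
              (hM s ⟨hs.1.le, hs.2.trans ht₀.2⟩) (norm_nonneg _))
          _ = ‖η' t₀ - η t₀‖ * ∫ s in a..t₀, ‖γ s‖ := by
            rw [intervalIntegral.integral_const_mul]
          _ ≤ _ := by
            refine mul_le_mul_of_nonneg_left ?_ (norm_nonneg _)
            exact intervalIntegral.integral_mono_interval le_rfl ht₀.1 ht₀.2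
              (Filter.Eventually.of_forall fun s => norm_nonneg _) (ii_of hγ ha hab hb).norm
      have hz : ‖η' t₀ - η t₀‖ = 0 := by
        have := norm_nonneg (η' t₀ - η t₀)
        nlinarith
      intro t ht
      rcases le_total t a with h | h
      · exact hP t ⟨ht.1, h⟩
      · have := hM t ⟨h, ht.2⟩
        rw [hz] at this
        exact norm_le_zero_iff.1 this
  intro t ht
  exact sub_eq_zero.1 (main t ht)
end

section
/- Let A be a real unital Banach algebra. There exists a smooth (C^∞ in the Fréchet sense) map Evol : L¹([0,1],A) → C([0,1],A), from the Lebesgue–Bochner space L¹([0,1],A) to the Banach space of continuous maps [0,1] → A with the supremum norm, such that for every u ∈ L¹([0,1],A) and every representative g : [0,1] → A of u one has Evol(u)(t) = 1 + ∫₀ᵗ Evol(u)(s)·g(s) ds for all t ∈ [0,1]. -/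
open MeasureTheory Set

attribute [local instance] MeasureTheory.Measure.Subtype.measureSpace

namespace Stmt18Aux

lemma ring_aux {R : Type*} [Ring R] (a b x : R) (h : a * b = 1) :
    1 - x = a * (1 - b * x * a) * b := by
  rw [mul_sub, sub_mul, mul_one, h]
  simp only [← mul_assoc]
  rw [h, one_mul, mul_assoc, h, mul_one]

lemma smooth_aux {X F : Type*} [NormedAddCommGroup X] [NormedSpace ℝ X]
    [NormedAddCommGroup F] [NormedSpace ℝ F] [CompleteSpace F]
    (V : X →L[ℝ] F →L[ℝ] F) (hV : ∀ u, IsUnit (1 - V u)) (x₀ : F) :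
    ContDiff ℝ ((⊤ : ℕ∞) : WithTop ℕ∞) (fun u => Ring.inverse (1 - V u) x₀) := by
  have h : ContDiff ℝ ((⊤ : ℕ∞) : WithTop ℕ∞) (fun u => Ring.inverse (1 - V u)) := by
    rw [contDiff_iff_contDiffAt]
    intro u
    obtain ⟨x, hx⟩ := hV u
    have h1 := contDiffAt_ringInverse ℝ (R := F →L[ℝ] F) (n := ((⊤ : ℕ∞) : WithTop ℕ∞)) x
    rw [hx] at h1
    exact h1.comp u (contDiff_const.sub V.contDiff).contDiffAt
  exact h.clm_apply contDiff_const

lemma ae_ne (t : Icc (0:ℝ) 1) : ∀ᵐ s ∂(volume : Measure (Icc (0:ℝ) 1)), s ≠ t := by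
  have h : (volume : Measure (Icc (0:ℝ) 1)) {t} = 0 := by
    change Measure.comap Subtype.val volume {t} = 0
    rw [(MeasurableEmbedding.subtype_coe measurableSet_Icc).comap_apply]
    simp
  exact measure_eq_zero_iff_ae_notMem.1 h

lemma meas_le (t : Icc (0:ℝ) 1) : MeasurableSet {s : Icc (0:ℝ) 1 | (s : ℝ) ≤ (t : ℝ)} :=
  measurableSet_le measurable_subtype_coe measurable_const

variable {A : Type*} [NormedRing A] [NormedAlgebra ℝ A]

lemma cont_int (F : Icc (0:ℝ) 1 → A) (hF : Integrable F volume) :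
    Continuous (fun t : Icc (0:ℝ) 1 =>
      ∫ s in {s : Icc (0:ℝ) 1 | (s : ℝ) ≤ (t : ℝ)}, F s ∂volume) := by
  have h1 : (fun t : Icc (0:ℝ) 1 => ∫ s in {s : Icc (0:ℝ) 1 | (s : ℝ) ≤ (t : ℝ)}, F s ∂volume)
      = fun t : Icc (0:ℝ) 1 =>
        ∫ s, ({s : Icc (0:ℝ) 1 | (s : ℝ) ≤ (t : ℝ)}).indicator F s ∂volume := by
    funext t
    rw [integral_indicator (meas_le t)]
  rw [h1, continuous_iff_continuousAt]
  intro t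
  refine continuousAt_of_dominated (bound := fun s => ‖F s‖) ?_ ?_ hF.norm ?_
  · exact Filter.Eventually.of_forall fun x => hF.aestronglyMeasurable.indicator (meas_le x)
  · exact Filter.Eventually.of_forall fun x => Filter.Eventually.of_forall fun a =>
      norm_indicator_le_norm_self _ _
  · filter_upwards [ae_ne t] with s hs
    rcases lt_or_gt_of_ne hs with h | h
    · refine (continuousAt_const (y := F s)).congr ?_
      filter_upwards [lt_mem_nhds h] with x hx
      rw [indicator_of_mem]
      exact le_of_lt hx
    · refine (continuousAt_const (y := (0:A))).congr ?_
      filter_upwards [gt_mem_nhds h] with x hx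
      rw [indicator_of_notMem]
      exact not_le.2 hx

lemma integ (u : Lp A 1 (volume : Measure (Icc (0:ℝ) 1))) (f : C(Icc (0:ℝ) 1, A)) :
    Integrable (fun s => f s * u s) volume :=
  (L1.integrable_coeFn u).bdd_mul f.continuous.aestronglyMeasurable
    (c := ‖f‖) (Filter.Eventually.of_forall fun s => f.norm_coe_le_norm s)

noncomputable def B (u : Lp A 1 (volume : Measure (Icc (0:ℝ) 1))) (f : C(Icc (0:ℝ) 1, A)) :
    C(Icc (0:ℝ) 1, A) :=
  ⟨fun t => ∫ s in {s : Icc (0:ℝ) 1 | (s : ℝ) ≤ (t : ℝ)}, f s * u s ∂volume,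
    cont_int _ (integ u f)⟩

lemma B_apply (u : Lp A 1 (volume : Measure (Icc (0:ℝ) 1))) (f : C(Icc (0:ℝ) 1, A))
    (t : Icc (0:ℝ) 1) :
    B u f t = ∫ s in {s : Icc (0:ℝ) 1 | (s : ℝ) ≤ (t : ℝ)}, f s * u s ∂volume := rfl

lemma bound_int (w : Icc (0:ℝ) 1 → ℝ) (S : Set (Icc (0:ℝ) 1)) (hS : MeasurableSet S)
    (hw : ∀ s ∈ S, |w s| ≤ 1)
    (u : Lp A 1 (volume : Measure (Icc (0:ℝ) 1))) (f : C(Icc (0:ℝ) 1, A)) :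
    ‖∫ s in S, w s • (f s * u s) ∂volume‖ ≤ ‖u‖ * ‖f‖ := by
  have hu := (L1.integrable_coeFn u).norm.mul_const ‖f‖
  calc ‖∫ s in S, w s • (f s * u s) ∂volume‖
      ≤ ∫ s in S, ‖u s‖ * ‖f‖ ∂volume := by
        refine norm_integral_le_of_norm_le hu.integrableOn ?_
        filter_upwards [ae_restrict_mem hS] with s hs
        rw [norm_smul, Real.norm_eq_abs]
        calc |w s| * ‖f s * u s‖ ≤ 1 * (‖f s‖ * ‖u s‖) := by
              gcongr
              · exact hw s hs
              · exact norm_mul_le _ _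
          _ ≤ ‖u s‖ * ‖f‖ := by
              rw [one_mul, mul_comm]
              gcongr
              exact f.norm_coe_le_norm s
    _ ≤ ∫ s, ‖u s‖ * ‖f‖ ∂volume :=
        setIntegral_le_integral hu (Filter.Eventually.of_forall fun s => by positivity)
    _ = ‖u‖ * ‖f‖ := by
        rw [integral_mul_const, L1.norm_eq_integral_norm]

variable (A) in
noncomputable def V : Lp A 1 (volume : Measure (Icc (0:ℝ) 1)) →L[ℝ]
    C(Icc (0:ℝ) 1, A) →L[ℝ] C(Icc (0:ℝ) 1, A) :=
  LinearMap.mkContinuous₂ (LinearMap.mk₂ ℝ B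
    (by
      intro u v f
      ext t
      rw [ContinuousMap.add_apply, B_apply, B_apply, B_apply,
        ← integral_add (integ u f).integrableOn (integ v f).integrableOn]
      refine integral_congr_ae (ae_restrict_of_ae ?_)
      filter_upwards [Lp.coeFn_add u v] with s hs
      rw [hs, Pi.add_apply, mul_add])
    (by
      intro c u f
      ext t
      rw [ContinuousMap.smul_apply, B_apply, B_apply, ← integral_smul]
      refine integral_congr_ae (ae_restrict_of_ae ?_)
      filter_upwards [Lp.coeFn_smul c u] with s hs
      rw [hs, Pi.smul_apply, mul_smul_comm])
    (by
      intro u f g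
      ext t
      rw [ContinuousMap.add_apply, B_apply, B_apply, B_apply,
        ← integral_add (integ u f).integrableOn (integ u g).integrableOn]
      simp only [ContinuousMap.add_apply, add_mul])
    (by
      intro c u f
      ext t
      rw [ContinuousMap.smul_apply, B_apply, B_apply, ← integral_smul]
      simp only [ContinuousMap.smul_apply, smul_mul_assoc])) 1
    (by
      intro u f
      rw [LinearMap.mk₂_apply, one_mul, ContinuousMap.norm_le _ (by positivity)]
      intro t
      rw [B_apply]
      have := bound_int (fun _ => 1) _ (meas_le t) (by simp) u f
      simpa using this)

lemma V_apply (u : Lp A 1 (volume : Measure (Icc (0:ℝ) 1))) (f : C(Icc (0:ℝ) 1, A))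
    (t : Icc (0:ℝ) 1) :
    V A u f t = ∫ s in {s : Icc (0:ℝ) 1 | (s : ℝ) ≤ (t : ℝ)}, f s * u s ∂volume := rfl

variable (A) in
noncomputable def e (K : ℝ) : C(Icc (0:ℝ) 1, A) :=
  ⟨fun t => Real.exp (K * t) • (1 : A), by fun_prop⟩

lemma e_apply (K : ℝ) (t : Icc (0:ℝ) 1) : e A K t = Real.exp (K * t) • (1 : A) := rfl

variable (A) in
noncomputable def E (K : ℝ) : C(Icc (0:ℝ) 1, A) →L[ℝ] C(Icc (0:ℝ) 1, A) :=
  ContinuousLinearMap.mul ℝ _ (e A K)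

lemma E_apply (K : ℝ) (f : C(Icc (0:ℝ) 1, A)) (t : Icc (0:ℝ) 1) :
    E A K f t = Real.exp (K * t) • f t := by
  simp [E, e_apply]

lemma E_mul (K : ℝ) : E A K * E A (-K) = 1 := by
  ext f t
  rw [mul_apply_eq_comp, E_apply, E_apply, smul_smul, ← Real.exp_add]
  simp

noncomputable def Eu (K : ℝ) : (C(Icc (0:ℝ) 1, A) →L[ℝ] C(Icc (0:ℝ) 1, A))ˣ :=
  ⟨E A K, E A (-K), E_mul K, by simpa using E_mul (A := A) (-K)⟩

lemma conj_apply (K : ℝ) (u : Lp A 1 (volume : Measure (Icc (0:ℝ) 1))) (f : C(Icc (0:ℝ) 1, A))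
    (t : Icc (0:ℝ) 1) :
    (E A (-K) * V A u * E A K) f t =
      ∫ s in {s : Icc (0:ℝ) 1 | (s : ℝ) ≤ (t : ℝ)},
        Real.exp (K * ((s : ℝ) - t)) • (f s * u s) ∂volume := by
  rw [mul_apply_eq_comp, mul_apply_eq_comp, E_apply, V_apply,
    ← integral_smul]
  congr 1
  funext s
  rw [E_apply, smul_mul_assoc, smul_smul, ← Real.exp_add]
  congr 2
  ring

lemma conj_le (K : ℝ) (hK : 0 ≤ K) (u : Lp A 1 (volume : Measure (Icc (0:ℝ) 1))) :
    ‖E A (-K) * V A u * E A K‖ ≤ ‖u‖ := by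
  refine ContinuousLinearMap.opNorm_le_bound _ (norm_nonneg _) fun f => ?_
  rw [ContinuousMap.norm_le _ (by positivity)]
  intro t
  rw [conj_apply]
  refine bound_int _ _ (meas_le t) ?_ u f
  intro s hs
  rw [abs_of_pos (Real.exp_pos _), Real.exp_le_one_iff]
  exact mul_nonpos_of_nonneg_of_nonpos hK (sub_nonpos.2 hs)

lemma exp_int (K : ℝ) (hK : 0 < K) (t : Icc (0:ℝ) 1) :
    ∫ s in {s : Icc (0:ℝ) 1 | (s : ℝ) ≤ (t : ℝ)}, Real.exp (K * ((s : ℝ) - t)) ∂volume ≤ 1 / K := by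
  rw [← integral_indicator (meas_le t)]
  have h1 : ∫ s : Icc (0:ℝ) 1, ({s : Icc (0:ℝ) 1 | (s : ℝ) ≤ (t : ℝ)}).indicator
      (fun s : Icc (0:ℝ) 1 => Real.exp (K * ((s : ℝ) - t))) s ∂volume
      = ∫ s in Icc (0:ℝ) 1, (Iic (t:ℝ)).indicator (fun s => Real.exp (K * (s - t))) s :=
    integral_subtype_comap measurableSet_Icc
      (fun s => (Iic (t:ℝ)).indicator (fun s => Real.exp (K * (s - t))) s)
  have h2 : Icc (0:ℝ) 1 ∩ Iic (t:ℝ) = Icc 0 (t:ℝ) := by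
    ext x
    have := t.2.2
    simp only [mem_inter_iff, mem_Icc, mem_Iic]
    constructor
    · rintro ⟨⟨a, b⟩, c⟩
      exact ⟨a, c⟩
    · rintro ⟨a, c⟩
      exact ⟨⟨a, c.trans this⟩, c⟩
  rw [h1, setIntegral_indicator measurableSet_Iic, h2, integral_Icc_eq_integral_Ioc,
    ← intervalIntegral.integral_of_le t.2.1]
  have h3 : ∀ x ∈ uIcc (0:ℝ) t, HasDerivAt (fun s => Real.exp (K * (s - t)) / K)
      (Real.exp (K * (x - t))) x := by
    intro x _
    have := ((((hasDerivAt_id x).sub_const (t:ℝ)).const_mul K).exp).div_const K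
    refine this.congr_deriv ?_
    simp only [id]
    field_simp
  rw [intervalIntegral.integral_eq_sub_of_hasDerivAt h3
    (Continuous.intervalIntegrable (by fun_prop) _ _)]
  rw [sub_self, mul_zero, Real.exp_zero]
  have : 0 ≤ Real.exp (K * (0 - t)) / K := by positivity
  linarith

lemma conj_le_cont (K : ℝ) (hK : 0 < K) (v : C(Icc (0:ℝ) 1, A)) :
    ‖E A (-K) * V A (ContinuousMap.toLp 1 volume ℝ v) * E A K‖ ≤ ‖v‖ / K := by
  refine ContinuousLinearMap.opNorm_le_bound _ (by positivity) fun f => ?_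
  rw [ContinuousMap.norm_le _ (by positivity)]
  intro t
  rw [conj_apply]
  have hi : Integrable (fun s : Icc (0:ℝ) 1 => Real.exp (K * ((s : ℝ) - t)) * (‖f‖ * ‖v‖))
      volume :=
    (Continuous.integrable_of_hasCompactSupport (by fun_prop)
      (HasCompactSupport.of_compactSpace _))
  calc _ ≤ ∫ s in {s : Icc (0:ℝ) 1 | (s : ℝ) ≤ (t : ℝ)},
        Real.exp (K * ((s : ℝ) - t)) * (‖f‖ * ‖v‖) ∂volume := by
        refine norm_integral_le_of_norm_le hi.integrableOn (ae_restrict_of_ae ?_)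
        filter_upwards [ContinuousMap.coeFn_toLp (p := 1) (𝕜 := ℝ) volume v] with s hs
        rw [hs, norm_smul, Real.norm_eq_abs, abs_of_pos (Real.exp_pos _)]
        gcongr
        refine (norm_mul_le _ _).trans ?_
        gcongr
        · exact f.norm_coe_le_norm s
        · exact v.norm_coe_le_norm s
    _ ≤ (1 / K) * (‖f‖ * ‖v‖) := by
        rw [integral_mul_const]
        gcongr
        exact exp_int K hK t
    _ = _ := by ring

lemma isUnit_V [CompleteSpace A] (u : Lp A 1 (volume : Measure (Icc (0:ℝ) 1))) :
    IsUnit (1 - V A u) := by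
  obtain ⟨v, hv⟩ := (ContinuousMap.toLp_denseRange A (volume : Measure (Icc (0:ℝ) 1)) ℝ
    (p := 1) (by simp)).exists_dist_lt u (ε := 1/2) (by norm_num)
  rw [dist_eq_norm] at hv
  set w := ContinuousMap.toLp 1 (volume : Measure (Icc (0:ℝ) 1)) ℝ v with hw
  set K : ℝ := 2 * ‖v‖ + 1 with hKdef
  have hK : 0 < K := by positivity
  have h1 := conj_le K hK.le (u - w)
  have h2 := conj_le_cont K hK v
  rw [← hw] at h2
  have h3 : ‖v‖ / K ≤ 1 / 2 := by
    rw [div_le_div_iff₀ hK (by norm_num)]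
    linarith
  have h4 : E A (-K) * V A u * E A K
      = E A (-K) * V A (u - w) * E A K + E A (-K) * V A w * E A K := by
    ext f t
    simp [mul_apply_eq_comp]
  have h5 : ‖E A (-K) * V A u * E A K‖ < 1 := by
    rw [h4]
    refine (norm_add_le (E := C(Icc (0:ℝ) 1, A) →L[ℝ] C(Icc (0:ℝ) 1, A)) _ _).trans_lt ?_
    linarith
  have h6 := isUnit_one_sub_of_norm_lt_one (R := C(Icc (0:ℝ) 1, A) →L[ℝ] C(Icc (0:ℝ) 1, A)) h5
  have h7 : 1 - V A u = E A K * (1 - E A (-K) * V A u * E A K) * E A (-K) := by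
    exact ring_aux (R := C(Icc (0:ℝ) 1, A) →L[ℝ] C(Icc (0:ℝ) 1, A)) _ _ _ (E_mul K)
  rw [h7]
  exact ((Eu (A := A) K).isUnit.mul h6).mul (Eu (A := A) K)⁻¹.isUnit

end Stmt18Aux

theorem stmt18
    {A : Type*} [NormedRing A] [NormedAlgebra ℝ A] [CompleteSpace A] :
    ∃ Evol : Lp A 1 (volume : Measure (Icc (0:ℝ) 1)) → C(Icc (0:ℝ) 1, A),
      ContDiff ℝ ((⊤ : ℕ∞) : WithTop ℕ∞) Evol ∧
      ∀ (u : Lp A 1 (volume : Measure (Icc (0:ℝ) 1))) (g : Icc (0:ℝ) 1 → A),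
        ⇑u =ᵐ[volume] g →
        ∀ t : Icc (0:ℝ) 1,
          Evol u t = 1 + ∫ s in {s : Icc (0:ℝ) 1 | (s : ℝ) ≤ (t : ℝ)},
            Evol u s * g s ∂volume := by
  refine ⟨fun u => Ring.inverse (1 - Stmt18Aux.V A u) 1, ?_, ?_⟩
  · exact Stmt18Aux.smooth_aux (Stmt18Aux.V A) Stmt18Aux.isUnit_V 1
  · intro u g hg t
    have h := Ring.mul_inverse_cancel _ (Stmt18Aux.isUnit_V u)
    have h2 := congrArg (fun T : C(Icc (0:ℝ) 1, A) →L[ℝ] C(Icc (0:ℝ) 1, A) => T 1 t) h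
    simp only [mul_apply_eq_comp, sub_apply,
      one_apply_eq_self, ContinuousMap.sub_apply, ContinuousMap.one_apply] at h2
    rw [sub_eq_iff_eq_add, Stmt18Aux.V_apply] at h2
    rw [h2]
    congr 1
    refine integral_congr_ae (ae_restrict_of_ae ?_)
    filter_upwards [hg] with s hs
    rw [hs]
end
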